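/- arXiv:1609.01939 — 12 statements merged into one kernel-verified Lean document; each statement's English description precedes it below -/
import Mathlib

section
/- There exists an absolute constant c > 0 with the following property: for all integers n, m with 2 ≤ n ≤ m, and every set S = {z_1, …, z_m} ⊆ ℤ^n of m distinct vectors in linear general position, the lattice zonotope Z = ∑_{i=1}^m [0, z_i] satisfies μ(Z) ≤ c · n · log n / (m − n + 1). -/
open Pointwise

/-- The covering radius of a set `K ⊆ ℝ^n` with respect to the lattice `ℤ^n`:
the infimum of all `ρ > 0` such that `ρK + ℤ^n = ℝ^n`. -/
noncomputable def covRad {n : ℕ} (K : Set (Fin n → ℝ)) : ℝ :=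
  sInf {ρ : ℝ | 0 < ρ ∧ ∀ x : Fin n → ℝ,
    ∃ (y : Fin n → ℝ) (k : Fin n → ℤ), y ∈ ρ • K ∧ x = y + fun i => (k i : ℝ)}

section

open MeasureTheory UnitAddTorus

/-- The Haar probability measure on the torus. -/
noncomputable abbrev torusHaar (n : ℕ) : Measure (UnitAddTorus (Fin n)) :=
  Measure.pi fun _ => AddCircle.haarAddCircle

lemma integral_fourier_haarAddCircle (k : ℤ) :
    ∫ x : UnitAddCircle, fourier k x ∂AddCircle.haarAddCircle = if k = 0 then 1 else 0 := by
  have h := congrFun (fourierCoeff_fourier (T := (1 : ℝ)) k) 0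
  simp only [fourierCoeff, neg_zero, fourier_zero, one_smul] at h
  rw [h]
  by_cases hk : k = 0
  · subst hk; simp
  · rw [Pi.single_eq_of_ne (Ne.symm hk), if_neg hk]

lemma integral_mFourier_torusHaar {n : ℕ} (w : Fin n → ℤ) :
    ∫ x, mFourier w x ∂torusHaar n = if w = 0 then 1 else 0 := by
  have h : ∀ x : UnitAddTorus (Fin n), mFourier w x = ∏ i, fourier (w i) (x i) := fun _ => rfl
  simp_rw [h]
  rw [integral_fintype_prod_eq_prod (𝕜 := ℂ) (fun i (y : UnitAddCircle) => fourier (w i) y)]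
  simp_rw [integral_fourier_haarAddCircle]
  split_ifs with hw
  · simp [hw]
  · obtain ⟨i, hi⟩ := Function.ne_iff.mp hw
    exact Finset.prod_eq_zero (Finset.mem_univ i) (if_neg hi)

lemma integrable_continuousMap_comp {n : ℕ} {Ω : Type*} [MeasurableSpace Ω] (γ : Measure Ω)
    [IsProbabilityMeasure γ] {Y : Ω → UnitAddTorus (Fin n)} (hY : Measurable Y)
    (f : C(UnitAddTorus (Fin n), ℂ)) : Integrable (fun ω => f (Y ω)) γ :=
  Integrable.of_bound (f.continuous.measurable.comp hY).aestronglyMeasurable ‖f‖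
    (Filter.Eventually.of_forall fun ω => f.norm_coe_le_norm (Y ω))

lemma norm_integral_comp_le {n : ℕ} {Ω : Type*} [MeasurableSpace Ω] (γ : Measure Ω)
    [IsProbabilityMeasure γ] {Y : Ω → UnitAddTorus (Fin n)}
    (f : C(UnitAddTorus (Fin n), ℂ)) : ‖∫ ω, f (Y ω) ∂γ‖ ≤ ‖f‖ := by
  simpa using norm_integral_le_of_norm_le_const (μ := γ) (f := fun ω => f (Y ω)) (C := ‖f‖)
    (Filter.Eventually.of_forall fun ω => f.norm_coe_le_norm (Y ω))

lemma continuous_integral_comp {n : ℕ} {Ω : Type*} [MeasurableSpace Ω] (γ : Measure Ω)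
    [IsProbabilityMeasure γ] {Y : Ω → UnitAddTorus (Fin n)} (hY : Measurable Y) :
    Continuous fun f : C(UnitAddTorus (Fin n), ℂ) => ∫ ω, f (Y ω) ∂γ := by
  refine LipschitzWith.continuous (K := 1) (LipschitzWith.of_dist_le_mul fun f g => ?_)
  rw [dist_eq_norm, dist_eq_norm, ← integral_sub (integrable_continuousMap_comp γ hY f)
    (integrable_continuousMap_comp γ hY g)]
  simpa using norm_integral_comp_le γ (Y := Y) (f - g)

lemma integral_mFourier_mul_finsuppSum {n : ℕ} {Ω : Type*} [MeasurableSpace Ω] (γ : Measure Ω)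
    [IsProbabilityMeasure γ] {Y : Ω → UnitAddTorus (Fin n)} (hY : Measurable Y)
    (c : (Fin n → ℤ) →₀ ℂ) (v : Fin n → ℤ) :
    ∫ ω, mFourier v (Y ω) * (c.sum fun i a => a • mFourier i : C(UnitAddTorus (Fin n), ℂ)) (Y ω) ∂γ =
      ∑ w ∈ c.support, c w * ∫ ω, mFourier (v + w) (Y ω) ∂γ := by
  have : ∀ ω, mFourier v (Y ω) *
      (c.sum fun i a => a • mFourier i : C(UnitAddTorus (Fin n), ℂ)) (Y ω) =
      ∑ w ∈ c.support, c w * mFourier (v + w) (Y ω) := by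
    intro ω
    simp only [Finsupp.sum, ContinuousMap.coe_sum, Finset.sum_apply,
      ContinuousMap.coe_smul, Pi.smul_apply, smul_eq_mul, Finset.mul_sum, mFourier_add]
    exact Finset.sum_congr rfl fun w _ => by ring
  simp_rw [this]
  rw [integral_finsetSum _ fun w _ => (integrable_continuousMap_comp γ hY _).const_mul _]
  simp_rw [integral_const_mul]

/-- If the nontrivial Fourier coefficients of a random point of the torus have absolute sum at most
`ε`, then expectations of continuous functions are `ε`-close to the Haar average. -/
lemma norm_integral_sub_torusHaar_le {n : ℕ} {Ω : Type*} [MeasurableSpace Ω] (γ : Measure Ω)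
    [IsProbabilityMeasure γ] {Y : Ω → UnitAddTorus (Fin n)} (hY : Measurable Y) {ε : ℝ}
    (hε : ∀ S : Finset (Fin n → ℤ), 0 ∉ S → ∑ w ∈ S, ‖∫ ω, mFourier w (Y ω) ∂γ‖ ≤ ε)
    (f : C(UnitAddTorus (Fin n), ℂ)) :
    ‖∫ ω, f (Y ω) ∂γ - ∫ x, f x ∂torusHaar n‖ ≤ ε * ‖f‖ := by
  have hcl : IsClosed {f : C(UnitAddTorus (Fin n), ℂ) |
      ‖∫ ω, f (Y ω) ∂γ - ∫ x, f x ∂torusHaar n‖ ≤ ε * ‖f‖} :=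
    isClosed_le ((continuous_integral_comp γ hY).sub
      (continuous_integral_comp (torusHaar n) measurable_id)).norm
      (continuous_const.mul continuous_norm)
  have hmem : f ∈ (Submodule.span ℂ (Set.range <| mFourier (d := Fin n))).topologicalClosure := by
    rw [span_mFourier_closure_eq_top]; trivial
  refine closure_minimal (fun g hg => ?_) hcl hmem
  obtain ⟨c, rfl⟩ := (Finsupp.mem_span_range_iff_exists_finsupp).1 hg
  set g : C(UnitAddTorus (Fin n), ℂ) := c.sum fun i a => a • mFourier i
  have hc : ∀ w ∈ c.support, ‖c w‖ ≤ ‖g‖ := by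
    intro w hw
    have h1 := integral_mFourier_mul_finsuppSum (torusHaar n) measurable_id c (-w)
    have h2 : ∀ x : Fin n → ℤ, (-w + x = 0) ↔ x = w := fun x => by
      rw [neg_add_eq_zero, eq_comm]
    simp only [id, integral_mFourier_torusHaar, h2, mul_ite, mul_one, mul_zero] at h1
    rw [Finset.sum_ite_eq' c.support w, if_pos hw] at h1
    rw [← h1]
    refine (norm_integral_comp_le (torusHaar n) (Y := id) (mFourier (-w) * g)).trans ?_
    exact (norm_mul_le _ _).trans (by rw [mFourier_norm, one_mul])
  have e1 := integral_mFourier_mul_finsuppSum γ hY c 0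
  have e2 := integral_mFourier_mul_finsuppSum (torusHaar n) measurable_id c 0
  simp only [mFourier_zero, ContinuousMap.one_apply, one_mul, zero_add, id] at e1 e2
  show ‖∫ ω, g (Y ω) ∂γ - ∫ x, g x ∂torusHaar n‖ ≤ ε * ‖g‖
  rw [e1, e2, ← Finset.sum_sub_distrib]
  classical
  rw [← Finset.sum_subset (Finset.erase_subset 0 c.support)]
  · refine (norm_sum_le _ _).trans ?_
    refine le_trans (Finset.sum_le_sum (g := fun w => ‖∫ ω, mFourier w (Y ω) ∂γ‖ * ‖g‖) ?_) ?_
    · intro w hw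
      rw [integral_mFourier_torusHaar, if_neg (Finset.ne_of_mem_erase hw), mul_zero, sub_zero,
        norm_mul, mul_comm]
      exact mul_le_mul_of_nonneg_left (hc w (Finset.mem_of_mem_erase hw)) (norm_nonneg _)
    · rw [← Finset.sum_mul]
      exact mul_le_mul_of_nonneg_right (hε _ (Finset.notMem_erase _ _)) (norm_nonneg _)
  · intro w hw hw'
    have : w = 0 := by
      by_contra h
      exact hw' (Finset.mem_erase.2 ⟨h, hw⟩)
    subst this
    rw [integral_mFourier_torusHaar, if_pos rfl, mFourier_zero]
    simp

lemma abs_integral_sub_torusHaar_le {n : ℕ} {Ω : Type*} [MeasurableSpace Ω] (γ : Measure Ω)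
    [IsProbabilityMeasure γ] {Y : Ω → UnitAddTorus (Fin n)} (hY : Measurable Y) {ε : ℝ}
    (hε : ∀ S : Finset (Fin n → ℤ), 0 ∉ S → ∑ w ∈ S, ‖∫ ω, mFourier w (Y ω) ∂γ‖ ≤ ε)
    (f : C(UnitAddTorus (Fin n), ℝ)) (hf : ∀ x, f x ∈ Set.Icc (0 : ℝ) 1) :
    |∫ ω, f (Y ω) ∂γ - ∫ x, f x ∂torusHaar n| ≤ ε := by
  let F : C(UnitAddTorus (Fin n), ℂ) :=
    ⟨fun x => (f x : ℂ), Complex.continuous_ofReal.comp f.continuous⟩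
  have hF : ‖F‖ ≤ 1 := (ContinuousMap.norm_le _ zero_le_one).2 fun x => by
    simpa [F, abs_of_nonneg (hf x).1] using (hf x).2
  have h := norm_integral_sub_torusHaar_le γ hY hε F
  have h1 : ∫ ω, F (Y ω) ∂γ = ((∫ ω, f (Y ω) ∂γ : ℝ) : ℂ) := integral_ofReal
  have h2 : ∫ x, F x ∂torusHaar n = ((∫ x, f x ∂torusHaar n : ℝ) : ℂ) := integral_ofReal
  rw [h1, h2, ← Complex.ofReal_sub, Complex.norm_real, Real.norm_eq_abs] at h
  have hε0 : 0 ≤ ε := by simpa using hε ∅ (Finset.notMem_empty 0)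
  exact h.trans (mul_le_of_le_one_right hε0 hF)

/-- A closed set containing a well-distributed random point of the torus with high probability has
`A + A` equal to the whole torus. -/
lemma exists_add_eq_of_equidistributed {n : ℕ} {Ω : Type*} [MeasurableSpace Ω] (γ : Measure Ω)
    [IsProbabilityMeasure γ] {Y : Ω → UnitAddTorus (Fin n)} (hY : Measurable Y)
    (hε : ∀ S : Finset (Fin n → ℤ), 0 ∉ S → ∑ w ∈ S, ‖∫ ω, mFourier w (Y ω) ∂γ‖ ≤ 1 / 4)
    {A : Set (UnitAddTorus (Fin n))} (hA : IsClosed A) {W : Ω → ℝ} (hW : Integrable W γ)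
    (hW0 : ∀ ω, 0 ≤ W ω) (hWA : ∀ ω, W ω < 1 → Y ω ∈ A) (hWint : ∫ ω, W ω ∂γ ≤ 1 / 8)
    (x : UnitAddTorus (Fin n)) : ∃ a ∈ A, ∃ b ∈ A, x = a + b := by
  by_contra! hx
  have hB : IsClosed ((fun t => x - t) ⁻¹' A) := hA.preimage (by fun_prop)
  have hdisj : Disjoint ((fun t => x - t) ⁻¹' A) A := by
    rw [Set.disjoint_left]
    intro t ht htA
    exact hx t htA (x - t) ht (by abel)
  obtain ⟨f, hf0, hf1, hf⟩ := exists_continuous_zero_one_of_isClosed hB hA hdisj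
  let f' : C(UnitAddTorus (Fin n), ℝ) := ⟨fun t => f (x - t), by fun_prop⟩
  have hYint : ∀ g : C(UnitAddTorus (Fin n), ℝ), Integrable (fun ω => g (Y ω)) γ := fun g =>
    Integrable.of_bound (g.continuous.measurable.comp hY).aestronglyMeasurable ‖g‖
      (Filter.Eventually.of_forall fun ω => g.norm_coe_le_norm (Y ω))
  have h1 := abs_le.1 (abs_integral_sub_torusHaar_le γ hY hε f hf)
  have h2 := abs_le.1 (abs_integral_sub_torusHaar_le γ hY hε f' fun t => hf (x - t))
  have : (AddCircle.haarAddCircle (T := 1)).IsNegInvariant := inferInstance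
  have h3 : ∫ t, f' t ∂torusHaar n = ∫ t, f t ∂torusHaar n :=
    integral_sub_left_eq_self (fun t => f t) (torusHaar n) x
  have h4 : ∫ ω, (1 - W ω) ∂γ ≤ ∫ ω, f (Y ω) ∂γ := by
    refine integral_mono ((integrable_const _).sub hW) (hYint f) fun ω => ?_
    by_cases h : W ω < 1
    · have := hf1 (hWA ω h)
      simp only [Pi.one_apply] at this
      simp only [this]
      linarith [hW0 ω]
    · linarith [(hf (Y ω)).1]
  have h5 : ∫ ω, f' (Y ω) ∂γ ≤ ∫ ω, W ω ∂γ := by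
    refine integral_mono (hYint f') hW fun ω => ?_
    by_cases h : W ω < 1
    · have : f (x - Y ω) = 0 := hf0 (by simpa using hWA ω h)
      simpa [f', this] using hW0 ω
    · have := (hf (x - Y ω)).2
      simp only [f', ContinuousMap.coe_mk]
      linarith
  rw [integral_sub (integrable_const _) hW] at h4
  simp only [integral_const, probReal_univ, smul_eq_mul, one_mul] at h4
  linarith [h1.1, h1.2, h2.1, h2.2]

/-- The standard Gaussian measure on `ℝ^m`. -/
noncomputable abbrev stdGaussianPi (m : ℕ) : Measure (Fin m → ℝ) :=
  Measure.pi fun _ => ProbabilityTheory.gaussianReal 0 1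

lemma integrable_exp_linear {m : ℕ} (b : Fin m → ℝ) :
    Integrable (fun η : Fin m → ℝ => Real.exp (∑ k, b k * η k)) (stdGaussianPi m) := by
  simp_rw [Real.exp_sum]
  exact Integrable.fintype_prod (f := fun k (t : ℝ) => Real.exp (b k * t)) fun k =>
    ProbabilityTheory.integrable_exp_mul_gaussianReal (b k)

lemma integral_exp_linear {m : ℕ} (b : Fin m → ℝ) :
    ∫ η, Real.exp (∑ k, b k * η k) ∂stdGaussianPi m = Real.exp ((∑ k, b k ^ 2) / 2) := by
  simp_rw [Real.exp_sum]
  rw [integral_fintype_prod_eq_prod (𝕜 := ℝ) (fun k (t : ℝ) => Real.exp (b k * t)), Finset.sum_div,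
    Real.exp_sum]
  refine Finset.prod_congr rfl fun k _ => ?_
  have h := congrFun (ProbabilityTheory.mgf_id_gaussianReal (μ := 0) (v := 1)) (b k)
  simpa [ProbabilityTheory.mgf] using h

lemma norm_integral_mFourier_gaussian {n m : ℕ} (g : Fin m → ℝ) (u : Fin m → Fin n → ℝ)
    (w : Fin n → ℤ) :
    ‖∫ η, mFourier w (fun i => ((∑ k, (g k * η k) • u k) i : UnitAddCircle)) ∂stdGaussianPi m‖ =
      Real.exp (-(2 * Real.pi ^ 2 * ∑ k, (g k * ∑ i, u k i * w i) ^ 2)) := by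
  have h : ∀ η : Fin m → ℝ, mFourier w (fun i => ((∑ k, (g k * η k) • u k) i : UnitAddCircle)) =
      ∏ k, Complex.exp (((2 * Real.pi * (g k * ∑ i, u k i * w i) : ℝ) : ℂ) * η k * Complex.I) := by
    intro η
    simp only [mFourier, ContinuousMap.coe_mk, fourier_coe_apply, Complex.ofReal_one, div_one]
    rw [← Complex.exp_sum, ← Complex.exp_sum]
    congr 1
    simp only [Finset.sum_apply, Pi.smul_apply, smul_eq_mul]
    push_cast
    simp only [Finset.mul_sum, Finset.sum_mul]
    rw [Finset.sum_comm]
    refine Finset.sum_congr rfl fun k _ => Finset.sum_congr rfl fun i _ => ?_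
    ring
  simp_rw [h]
  rw [integral_fintype_prod_eq_prod (𝕜 := ℂ) (fun k (t : ℝ) =>
    Complex.exp (((2 * Real.pi * (g k * ∑ i, u k i * w i) : ℝ) : ℂ) * t * Complex.I)), norm_prod,
    Finset.mul_sum, ← Finset.sum_neg_distrib, Real.exp_sum]
  refine Finset.prod_congr rfl fun k _ => ?_
  rw [← charFun_apply_real, ProbabilityTheory.charFun_gaussianReal, Complex.norm_exp]
  congr 1
  simp
  ring_nf
  norm_cast
  simp
  ring

/-- Few lattice points have small norm: points of norm less than `k` are distinct modulo `k`. -/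
lemma card_le_pow_of_norm_lt {n : ℕ} {E : Type*} [NormedAddCommGroup E] [NormedSpace ℝ E]
    (φ : (Fin n → ℤ) →+ E) (hφ : ∀ w, w ≠ 0 → 2 ≤ ‖φ w‖) (k : ℕ) (hk : 0 < k)
    (S : Finset (Fin n → ℤ)) (hS : ∀ w ∈ S, ‖φ w‖ < k) : S.card ≤ k ^ n := by
  have : NeZero k := ⟨hk.ne'⟩
  have hinj : Set.InjOn (fun (w : Fin n → ℤ) (i : Fin n) => (w i : ZMod k)) S := by
    intro w hw v hv hwv
    have hd : ∀ i, ∃ u : ℤ, w i - v i = k * u := fun i => by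
      have h := congrFun hwv i
      exact (ZMod.intCast_eq_intCast_iff_dvd_sub (v i) (w i) k).1 h.symm
    choose u hu using hd
    have hwu : w - v = k • u := by
      ext i; simp [hu i]
    by_contra hne
    have hu0 : u ≠ 0 := by
      rintro rfl
      exact hne (sub_eq_zero.1 (by simpa using hwu))
    have h1 : ‖φ (w - v)‖ = k * ‖φ u‖ := by
      rw [hwu, map_nsmul, ← Nat.cast_smul_eq_nsmul ℝ, norm_smul]; simp
    have h2 : ‖φ (w - v)‖ < k + k := by
      rw [map_sub]
      exact (norm_sub_le _ _).trans_lt (add_lt_add (hS w hw) (hS v hv))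
    have hk' : (0 : ℝ) < k := by exact_mod_cast hk
    nlinarith [hφ u hu0]
  calc S.card ≤ (Finset.univ : Finset (Fin n → ZMod k)).card :=
        Finset.card_le_card_of_injOn _ (fun _ _ => Finset.mem_coe.2 (Finset.mem_univ _)) hinj
    _ = k ^ n := by simp [ZMod.card]

lemma sum_gaussian_le_quarter {n : ℕ} (hn : 1 ≤ n) {E : Type*} [NormedAddCommGroup E]
    [NormedSpace ℝ E]
    (φ : (Fin n → ℤ) →+ E) (hφ : ∀ w, w ≠ 0 → 2 ≤ ‖φ w‖) (S : Finset (Fin n → ℤ)) (hS : 0 ∉ S) :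
    ∑ w ∈ S, Real.exp (-(4 * n * ‖φ w‖ ^ 2)) ≤ 1 / 4 := by
  classical
  have hn' : (1 : ℝ) ≤ n := by exact_mod_cast hn
  have hκ : ∀ w ∈ S, ⌊‖φ w‖⌋₊ ∈ S.image fun w => ⌊‖φ w‖⌋₊ := fun w hw =>
    Finset.mem_image_of_mem _ hw
  rw [← Finset.sum_fiberwise_of_maps_to hκ]
  have hexp : Real.exp (-3) ≤ 1 / 8 := by
    have h1 : (2 : ℝ) ≤ Real.exp 1 := by linarith [Real.add_one_le_exp (1 : ℝ)]
    have h2 : Real.exp 3 = Real.exp 1 ^ 3 := by rw [← Real.exp_nat_mul]; norm_num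
    rw [Real.exp_neg, one_div]
    apply inv_anti₀ (by norm_num)
    rw [h2]
    calc (8 : ℝ) = 2 ^ 3 := by norm_num
      _ ≤ _ := by gcongr
  have hfib : ∀ k ∈ S.image (fun w => ⌊‖φ w‖⌋₊),
      ∑ w ∈ S with ⌊‖φ w‖⌋₊ = k, Real.exp (-(4 * n * ‖φ w‖ ^ 2)) ≤ (1 / 8 : ℝ) ^ k := by
    intro k hk
    obtain ⟨w₀, hw₀, rfl⟩ := Finset.mem_image.1 hk
    set k := ⌊‖φ w₀‖⌋₊
    have hk2 : 2 ≤ k := Nat.le_floor (by exact_mod_cast hφ w₀ fun h => hS (h ▸ hw₀))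
    have hk2' : (2 : ℝ) ≤ k := by exact_mod_cast hk2
    have hcard : (S.filter fun w => ⌊‖φ w‖⌋₊ = k).card ≤ (k + 1) ^ n := by
      apply card_le_pow_of_norm_lt φ hφ (k + 1) (by omega)
      intro w hw
      rw [← (Finset.mem_filter.1 hw).2]
      exact_mod_cast Nat.lt_floor_add_one ‖φ w‖
    have hterm : ∀ w ∈ S.filter (fun w => ⌊‖φ w‖⌋₊ = k),
        Real.exp (-(4 * n * ‖φ w‖ ^ 2)) ≤ Real.exp (-(4 * n * k)) := by
      intro w hw
      have h1 : (k : ℝ) ≤ ‖φ w‖ := by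
        rw [← (Finset.mem_filter.1 hw).2]
        exact Nat.floor_le (norm_nonneg _)
      apply Real.exp_le_exp.2
      have : (k : ℝ) ≤ ‖φ w‖ ^ 2 := by nlinarith
      nlinarith
    have hk1 : ((k : ℝ) + 1) ^ n ≤ Real.exp (n * k) := by
      rw [Real.exp_nat_mul]
      gcongr
      exact Real.add_one_le_exp _
    calc _ ≤ (S.filter fun w => ⌊‖φ w‖⌋₊ = k).card • Real.exp (-(4 * n * k)) :=
          Finset.sum_le_card_nsmul _ _ _ hterm
      _ ≤ Real.exp (n * k) * Real.exp (-(4 * n * k)) := by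
          rw [nsmul_eq_mul]
          gcongr
          exact le_trans (by exact_mod_cast hcard) hk1
      _ = Real.exp (-(3 * n * k)) := by rw [← Real.exp_add]; ring_nf
      _ ≤ Real.exp (k * (-3)) := by
          apply Real.exp_le_exp.2
          nlinarith
      _ ≤ (1 / 8 : ℝ) ^ k := by
          rw [Real.exp_nat_mul]
          gcongr
  refine (Finset.sum_le_sum hfib).trans ?_
  have hsum : HasSum (fun k : ℕ => (1 / 8 : ℝ) ^ k * (1 / 8)) ((1 - 1 / 8)⁻¹ * (1 / 8)) :=
    (hasSum_geometric_of_lt_one (by norm_num) (by norm_num)).mul_right _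
  have himg : ∀ k ∈ S.image (fun w => ⌊‖φ w‖⌋₊), 1 ≤ k := by
    intro k hk
    obtain ⟨w, hw, rfl⟩ := Finset.mem_image.1 hk
    exact Nat.le_floor (by
      have := hφ w fun h => hS (h ▸ hw)
      push_cast; linarith)
  generalize S.image (fun w => ⌊‖φ w‖⌋₊) = K at himg
  calc ∑ k ∈ K, (1 / 8 : ℝ) ^ k = ∑ k ∈ K.image (fun k => k - 1), (1 / 8 : ℝ) ^ k * (1 / 8) := by
        rw [Finset.sum_image]
        · refine Finset.sum_congr rfl fun k hk => ?_
          rw [← pow_succ, Nat.sub_add_cancel (himg k hk)]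
        · intro a ha b hb hab
          have := himg a ha
          have := himg b hb
          simp only at hab
          omega
    _ ≤ _ := sum_le_hasSum _ (fun _ _ => by positivity) hsum
    _ ≤ 1 / 4 := by norm_num

open Matrix in
/-- The Gram matrix `∑ i, (a i)⁻¹ v i (v i)ᵀ`. -/
noncomputable def weightedGram {n m : ℕ} (v : Fin m → Fin n → ℝ) (a : Fin m → ℝ) :
    Matrix (Fin n) (Fin n) ℝ :=
  ∑ i, (a i)⁻¹ • vecMulVec (v i) (v i)

open Matrix in
/-- The bilinear form of the inverse of the weighted Gram matrix. -/
noncomputable def leverage {n m : ℕ} (v : Fin m → Fin n → ℝ) (a : Fin m → ℝ)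
    (x y : Fin n → ℝ) : ℝ :=
  x ⬝ᵥ (weightedGram v a)⁻¹ *ᵥ y

section Leverage

open Matrix

variable {n m : ℕ} {v : Fin m → Fin n → ℝ} {a b : Fin m → ℝ}

lemma weightedGram_mulVec (v : Fin m → Fin n → ℝ) (a : Fin m → ℝ) (x : Fin n → ℝ) :
    weightedGram v a *ᵥ x = ∑ i, ((a i)⁻¹ * (v i ⬝ᵥ x)) • v i := by
  simp only [weightedGram, sum_mulVec, smul_mulVec, vecMulVec_mulVec]
  refine Finset.sum_congr rfl fun i _ => ?_
  ext j
  simp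
  ring

lemma weightedGram_mulVec_dotProduct (v : Fin m → Fin n → ℝ) (a : Fin m → ℝ) (x y : Fin n → ℝ) :
    weightedGram v a *ᵥ x ⬝ᵥ y = ∑ i, (a i)⁻¹ * ((v i ⬝ᵥ x) * (v i ⬝ᵥ y)) := by
  rw [weightedGram_mulVec, sum_dotProduct]
  exact Finset.sum_congr rfl fun i _ => by rw [smul_dotProduct, smul_eq_mul, mul_assoc]

lemma weightedGram_posDef (hv : ∀ w, (∀ i, v i ⬝ᵥ w = 0) → w = 0) (ha : ∀ i, 0 < a i) :
    (weightedGram v a).PosDef := by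
  refine PosDef.of_dotProduct_mulVec_pos ?_ fun x hx => ?_
  · simp only [IsHermitian, weightedGram, conjTranspose_sum, conjTranspose_smul,
      conjTranspose_vecMulVec, star_trivial]
  · rw [star_trivial, dotProduct_comm, weightedGram_mulVec_dotProduct]
    have : ∃ i, v i ⬝ᵥ x ≠ 0 := by
      by_contra! h
      exact hx (hv x h)
    obtain ⟨i, hi⟩ := this
    refine Finset.sum_pos' (fun j _ => ?_) ⟨i, Finset.mem_univ i, ?_⟩
    · exact mul_nonneg (inv_nonneg.2 (ha j).le) (mul_self_nonneg _)
    · exact mul_pos (inv_pos.2 (ha i)) (mul_self_pos.2 hi)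

lemma weightedGram_mulVec_inv (hv : ∀ w, (∀ i, v i ⬝ᵥ w = 0) → w = 0) (ha : ∀ i, 0 < a i)
    (x : Fin n → ℝ) : weightedGram v a *ᵥ ((weightedGram v a)⁻¹ *ᵥ x) = x := by
  rw [mulVec_mulVec, mul_nonsing_inv _ ((isUnit_iff_isUnit_det _).1
    (weightedGram_posDef hv ha).isUnit), one_mulVec]

lemma sum_leverage_smul (hv : ∀ w, (∀ i, v i ⬝ᵥ w = 0) → w = 0) (ha : ∀ i, 0 < a i)
    (x : Fin n → ℝ) : ∑ i, ((a i)⁻¹ * leverage v a (v i) x) • v i = x := by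
  conv_rhs => rw [← weightedGram_mulVec_inv hv ha x, weightedGram_mulVec]
  rfl

lemma leverage_eq_sum (hv : ∀ w, (∀ i, v i ⬝ᵥ w = 0) → w = 0) (ha : ∀ i, 0 < a i)
    (x y : Fin n → ℝ) :
    leverage v a x y = ∑ i, (a i)⁻¹ * (leverage v a (v i) x * leverage v a (v i) y) := by
  conv_lhs => rw [leverage]; enter [1]; rw [← weightedGram_mulVec_inv hv ha x]
  rw [weightedGram_mulVec_dotProduct]
  rfl

lemma leverage_comm (hv : ∀ w, (∀ i, v i ⬝ᵥ w = 0) → w = 0) (ha : ∀ i, 0 < a i)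
    (x y : Fin n → ℝ) : leverage v a x y = leverage v a y x := by
  rw [leverage_eq_sum hv ha x y, leverage_eq_sum hv ha y x]
  simp_rw [mul_comm (leverage v a _ x)]

lemma leverage_self_pos (hv : ∀ w, (∀ i, v i ⬝ᵥ w = 0) → w = 0) (ha : ∀ i, 0 < a i)
    {x : Fin n → ℝ} (hx : x ≠ 0) : 0 < leverage v a x x := by
  simpa [leverage] using (weightedGram_posDef hv ha).inv.dotProduct_mulVec_pos hx

lemma sq_sum_weighted_le {ι : Type*} (s : Finset ι) {c f g : ι → ℝ} (hc : ∀ i ∈ s, 0 ≤ c i) :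
    (∑ i ∈ s, c i * (f i * g i)) ^ 2 ≤
      (∑ i ∈ s, c i * (f i * f i)) * ∑ i ∈ s, c i * (g i * g i) :=
  Finset.sum_sq_le_sum_mul_sum_of_sq_le_mul s
    (fun i hi => mul_nonneg (hc i hi) (mul_self_nonneg _))
    (fun i hi => mul_nonneg (hc i hi) (mul_self_nonneg _)) (fun i _ => le_of_eq (by ring))

lemma leverage_sq_le (hv : ∀ w, (∀ i, v i ⬝ᵥ w = 0) → w = 0) (ha : ∀ i, 0 < a i)
    (x y : Fin n → ℝ) : leverage v a x y ^ 2 ≤ leverage v a x x * leverage v a y y := by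
  rw [leverage_eq_sum hv ha x y, leverage_eq_sum hv ha x x, leverage_eq_sum hv ha y y]
  exact sq_sum_weighted_le _ fun i _ => inv_nonneg.2 (ha i).le

lemma leverage_self_le_mul (hv : ∀ w, (∀ i, v i ⬝ᵥ w = 0) → w = 0) (ha : ∀ i, 0 < a i)
    (hb : ∀ i, 0 < b i) {β : ℝ} (hab : ∀ i, a i ≤ β * b i) {x : Fin n → ℝ} (hx : x ≠ 0) :
    leverage v a x x ≤ β * leverage v b x x := by
  set p := (weightedGram v a)⁻¹ *ᵥ x with hp
  set q := (weightedGram v b)⁻¹ *ᵥ x with hq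
  have hpos := leverage_self_pos hv ha hx
  have h1 : leverage v a x x = ∑ i, (b i)⁻¹ * ((v i ⬝ᵥ q) * (v i ⬝ᵥ p)) := by
    rw [← weightedGram_mulVec_dotProduct, hq, weightedGram_mulVec_inv hv hb]
    rfl
  have h2 : leverage v b x x = ∑ i, (b i)⁻¹ * ((v i ⬝ᵥ q) * (v i ⬝ᵥ q)) := by
    rw [← weightedGram_mulVec_dotProduct, hq, weightedGram_mulVec_inv hv hb]
    rfl
  have h3 : leverage v a x x = ∑ i, (a i)⁻¹ * ((v i ⬝ᵥ p) * (v i ⬝ᵥ p)) := by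
    rw [← weightedGram_mulVec_dotProduct, hp, weightedGram_mulVec_inv hv ha]
    rfl
  have h4 : ∑ i, (b i)⁻¹ * ((v i ⬝ᵥ p) * (v i ⬝ᵥ p)) ≤ β * leverage v a x x := by
    rw [h3, Finset.mul_sum]
    refine Finset.sum_le_sum fun i _ => ?_
    rw [← mul_assoc β]
    refine mul_le_mul_of_nonneg_right ?_ (mul_self_nonneg _)
    rw [← div_eq_mul_inv, le_div_iff₀ (ha i), inv_mul_le_iff₀ (hb i)]
    linarith [hab i, mul_comm β (b i)]
  have h5 := sq_sum_weighted_le Finset.univ (c := fun i => (b i)⁻¹) (f := fun i => v i ⬝ᵥ q)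
    (g := fun i => v i ⬝ᵥ p) fun i _ => (inv_pos.2 (hb i)).le
  rw [← h1, ← h2] at h5
  have h6 : leverage v a x x * leverage v a x x ≤
      (β * leverage v b x x) * leverage v a x x := by
    have := mul_le_mul_of_nonneg_left h4 (leverage_self_pos hv hb hx).le
    nlinarith
  exact le_of_mul_le_mul_right h6 hpos

lemma sum_leverage_self (hv : ∀ w, (∀ i, v i ⬝ᵥ w = 0) → w = 0) (ha : ∀ i, 0 < a i) :
    ∑ i, (a i)⁻¹ * leverage v a (v i) (v i) = n := by
  have h : ((weightedGram v a)⁻¹ * weightedGram v a).trace = n := by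
    rw [nonsing_inv_mul _ ((isUnit_iff_isUnit_det _).1 (weightedGram_posDef hv ha).isUnit)]
    simp
  rw [← h]
  conv_rhs => enter [1, 2]; rw [weightedGram]
  rw [Finset.mul_sum, trace_sum]
  refine Finset.sum_congr rfl fun i _ => ?_
  rw [mul_smul_comm, trace_smul, mul_vecMulVec, trace_vecMulVec, dotProduct_comm, leverage,
    smul_eq_mul]

/-- The map `a ↦ √(leverage v a (v i) (v i))` contracts logarithmic distance by a factor two, so
its iterates come within a factor two of being fixed. -/
lemma exists_almost_fixed_weights (hv : ∀ w, (∀ i, v i ⬝ᵥ w = 0) → w = 0) (hv0 : ∀ i, v i ≠ 0) :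
    ∃ a : Fin m → ℝ, (∀ i, 0 < a i) ∧ (∀ i, √(leverage v a (v i) (v i)) ≤ 2 * a i) ∧
      ∀ i, a i ≤ 2 * √(leverage v a (v i) (v i)) := by
  have key : ∀ k : ℕ, ∀ α : ℝ, 0 ≤ α → α ≤ 2 ^ 2 ^ k →
      ∀ a : Fin m → ℝ, (∀ i, 0 < a i) → (∀ i, √(leverage v a (v i) (v i)) ≤ α * a i) →
      (∀ i, a i ≤ α * √(leverage v a (v i) (v i))) →
      ∃ a : Fin m → ℝ, (∀ i, 0 < a i) ∧ (∀ i, √(leverage v a (v i) (v i)) ≤ 2 * a i) ∧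
      ∀ i, a i ≤ 2 * √(leverage v a (v i) (v i)) := by
    intro k
    induction k with
    | zero =>
      intro α h0 hα a ha h1 h2
      norm_num at hα
      exact ⟨a, ha, fun i => (h1 i).trans (by have := ha i; gcongr),
        fun i => (h2 i).trans (by gcongr)⟩
    | succ k ih =>
      intro α h0 hα a ha h1 h2
      have hF : ∀ i, 0 < √(leverage v a (v i) (v i)) := fun i =>
        Real.sqrt_pos.2 (leverage_self_pos hv ha (hv0 i))
      refine ih (√α) (Real.sqrt_nonneg _) ?_ (fun i => √(leverage v a (v i) (v i))) hF ?_ ?_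
      · rw [Real.sqrt_le_left (by positivity), ← pow_mul, ← pow_succ]
        exact hα
      · intro i
        rw [← Real.sqrt_mul h0]
        exact Real.sqrt_le_sqrt (leverage_self_le_mul hv hF ha h1 (hv0 i))
      · intro i
        rw [← Real.sqrt_mul h0]
        exact Real.sqrt_le_sqrt (leverage_self_le_mul hv ha hF h2 (hv0 i))
  set F : Fin m → ℝ := fun i => √(leverage v 1 (v i) (v i)) with hF_def
  have hF : ∀ i, 0 < F i := fun i =>
    Real.sqrt_pos.2 (leverage_self_pos hv (fun _ => one_pos) (hv0 i))
  set α := ∑ i, (F i + (F i)⁻¹) with hα_def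
  have hα : ∀ i, F i + (F i)⁻¹ ≤ α := fun i =>
    Finset.single_le_sum (f := fun i => F i + (F i)⁻¹)
      (fun j _ => by have := hF j; positivity) (Finset.mem_univ i)
  obtain ⟨k, hk⟩ := pow_unbounded_of_one_lt α (one_lt_two (α := ℝ))
  refine key k α (Finset.sum_nonneg fun j _ => by have := hF j; positivity) ?_ 1
    (fun _ => one_pos) ?_ ?_
  · refine hk.le.trans (pow_le_pow_right₀ one_le_two (Nat.lt_two_pow_self).le)
  · intro i
    have := inv_pos.2 (hF i)
    simp only [Pi.one_apply, mul_one]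
    linarith [hα i]
  · intro i
    have h1 : (F i)⁻¹ ≤ α := by linarith [hα i, hF i]
    calc (1 : ℝ) = (F i)⁻¹ * F i := (inv_mul_cancel₀ (hF i).ne').symm
      _ ≤ α * F i := mul_le_mul_of_nonneg_right h1 (hF i).le

/-- Approximate `ℓ₁` Lewis weights. -/
lemma exists_lewis_weights (hv : ∀ w, (∀ i, v i ⬝ᵥ w = 0) → w = 0) (hv0 : ∀ i, v i ≠ 0) :
    ∃ (a : Fin m → ℝ) (B : Fin m → Fin m → ℝ), (∀ i, 0 < a i) ∧ ∑ i, a i ≤ 4 * n ∧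
      (∀ j, ∑ i, ((a i)⁻¹ * B i j) • v i = v j) ∧
      (∀ i, ∑ k, (a k)⁻¹ * B i k ^ 2 ≤ (2 * a i) ^ 2) ∧
      ∀ i j, |B i j| ≤ (2 * a i) * (2 * a j) := by
  obtain ⟨a, ha, h1, h2⟩ := exists_almost_fixed_weights hv hv0
  have hself : ∀ i, leverage v a (v i) (v i) ≤ (2 * a i) ^ 2 := fun i =>
    (Real.sqrt_le_left (by have := ha i; positivity)).1 (h1 i)
  refine ⟨a, fun i j => leverage v a (v i) (v j), ha, ?_, ?_, ?_, ?_⟩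
  · rw [← sum_leverage_self hv ha, Finset.mul_sum]
    refine Finset.sum_le_sum fun i _ => ?_
    have h3 : 0 < leverage v a (v i) (v i) := leverage_self_pos hv ha (hv0 i)
    have h4 : a i ^ 2 ≤ 4 * leverage v a (v i) (v i) := by
      have := pow_le_pow_left₀ (ha i).le (h2 i) 2
      rw [mul_pow, Real.sq_sqrt h3.le] at this
      linarith
    rw [mul_left_comm, ← div_eq_inv_mul, le_div_iff₀ (ha i)]
    nlinarith
  · exact fun j => sum_leverage_smul hv ha (v j)
  · intro i
    refine le_trans (le_of_eq ?_) (hself i)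
    rw [leverage_eq_sum hv ha (v i) (v i)]
    exact Finset.sum_congr rfl fun k _ => by
      rw [leverage_comm hv ha (v k) (v i), sq]
  · intro i j
    apply abs_le_of_sq_le_sq
    · refine (leverage_sq_le hv ha _ _).trans ?_
      rw [mul_pow]
      exact mul_le_mul (hself i) (hself j) (leverage_self_pos hv ha (hv0 j)).le (sq_nonneg _)
    · have := ha i
      have := ha j
      positivity

end Leverage

open Matrix in
/-- A zonotope all of whose lattice widths are at least `N` has covering radius of order
`n log n / N`. -/
lemma exists_zonotope_add_int {n m : ℕ} (hn : 2 ≤ n) (v : Fin m → Fin n → ℝ)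
    (hv : ∀ w, (∀ i, v i ⬝ᵥ w = 0) → w = 0) (hv0 : ∀ i, v i ≠ 0) {N : ℝ} (hN : 0 < N)
    (hwidth : ∀ w : Fin n → ℤ, w ≠ 0 → N ≤ ∑ i, |∑ j, v i j * w j|) (x : Fin n → ℝ) :
    ∃ τ : Fin m → ℝ, (∀ i, |τ i| ≤ 2 * (2 * n / N * (Real.log n + 10))) ∧
      ∃ k : Fin n → ℤ, x = ∑ i, τ i • v i + fun j => (k j : ℝ) := by
  obtain ⟨a, B, ha, hasum, hB1, hB2, hB3⟩ := exists_lewis_weights hv hv0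
  have hn0 : (0 : ℝ) < n := by positivity
  have hsq : ∀ k, √(a k) ^ 2 = a k := fun k => Real.sq_sqrt (ha k).le
  set s : ℝ := 2 * n / N with hs
  have hs0 : 0 < s := by positivity
  set T : ℝ := Real.log n + 8 with hT
  have hT0 : 0 ≤ T := by
    have := Real.log_natCast_nonneg n
    positivity
  set g : Fin m → ℝ := fun k => s * (√(a k))⁻¹ with hg
  set b : Fin m → Fin m → ℝ := fun i k => (a i)⁻¹ * (√(a k))⁻¹ * B i k with hb
  set t : (Fin m → ℝ) → Fin m → ℝ := fun η i => ∑ k, b i k * η k with ht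
  set e : (Fin m → ℝ) → Fin m → ℝ := fun η i => t η i - max (-T) (min T (t η i)) with he
  set Y : (Fin m → ℝ) → UnitAddTorus (Fin n) := fun η i =>
    ((∑ k, (g k * η k) • v k) i : UnitAddCircle) with hYdef
  set W : (Fin m → ℝ) → ℝ := fun η =>
    ∑ j, 2 * a j * (Real.exp (-T) * (Real.exp (∑ k, b j k * η k) + Real.exp (∑ k, -b j k * η k)))
    with hWdef
  set A : Set (UnitAddTorus (Fin n)) :=
    (fun (τ : Fin m → ℝ) (i : Fin n) => ((∑ k, τ k • v k) i : UnitAddCircle)) ''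
      Set.Icc (fun _ => -(s * (T + 2))) (fun _ => s * (T + 2)) with hAdef
  have hA : IsClosed A := by
    refine (isCompact_Icc.image ?_).isClosed
    refine continuous_pi fun i => (AddCircle.continuous_mk' (1 : ℝ)).comp ?_
    simp only [Finset.sum_apply, Pi.smul_apply, smul_eq_mul]
    fun_prop
  have hY : Measurable Y := by
    refine measurable_pi_lambda _ fun i => AddCircle.measurable_mk'.comp ?_
    simp only [Finset.sum_apply, Pi.smul_apply, smul_eq_mul]
    fun_prop
  have hbsum : ∀ j, ∑ k, b j k ^ 2 ≤ 4 := by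
    intro j
    have h1 : ∑ k, b j k ^ 2 = (a j)⁻¹ ^ 2 * ∑ k, (a k)⁻¹ * B j k ^ 2 := by
      rw [Finset.mul_sum]
      refine Finset.sum_congr rfl fun k _ => ?_
      rw [hb, ← hsq k]
      simp only [mul_pow, inv_pow, hsq k]
      ring
    rw [h1]
    calc (a j)⁻¹ ^ 2 * ∑ k, (a k)⁻¹ * B j k ^ 2 ≤ (a j)⁻¹ ^ 2 * (2 * a j) ^ 2 := by
          have := hB2 j
          gcongr
      _ = 4 := by
          have := (ha j).ne'
          field_simp
          norm_num
  have hI : ∀ j, Integrable (fun η : Fin m → ℝ => 2 * a j * (Real.exp (-T) *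
      (Real.exp (∑ k, b j k * η k) + Real.exp (∑ k, -b j k * η k)))) (stdGaussianPi m) :=
    fun j => (((integrable_exp_linear (b j)).add
      (integrable_exp_linear fun k => -b j k)).const_mul _).const_mul _
  have hW : Integrable W (stdGaussianPi m) := integrable_finsetSum _ fun j _ => hI j
  have hW0 : ∀ η, 0 ≤ W η := fun η => Finset.sum_nonneg fun j _ => by
    have := ha j
    positivity
  have hWint : ∫ η, W η ∂stdGaussianPi m ≤ 1 / 8 := by
    have h1 : ∫ η, W η ∂stdGaussianPi m =
        ∑ j, 2 * a j * (Real.exp (-T) * (2 * Real.exp ((∑ k, b j k ^ 2) / 2))) := by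
      simp only [hWdef]
      rw [integral_finsetSum _ fun j _ => hI j]
      refine Finset.sum_congr rfl fun j _ => ?_
      rw [integral_const_mul, integral_const_mul, integral_add (integrable_exp_linear (b j))
        (integrable_exp_linear fun k => -b j k), integral_exp_linear (b j),
        integral_exp_linear fun k => -b j k]
      simp only [neg_sq]
      ring
    have h2 : ∑ j, 2 * a j * (Real.exp (-T) * (2 * Real.exp ((∑ k, b j k ^ 2) / 2))) ≤
        ∑ j, a j * (4 * (Real.exp (-T) * Real.exp 2)) := by
      refine Finset.sum_le_sum fun j _ => ?_
      have h3 : Real.exp ((∑ k, b j k ^ 2) / 2) ≤ Real.exp 2 :=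
        Real.exp_le_exp.2 (by linarith [hbsum j])
      have h4 : 0 ≤ a j * Real.exp (-T) := by
        have := ha j
        positivity
      nlinarith
    have h5 : Real.exp (-T) * Real.exp 2 = (n : ℝ)⁻¹ * Real.exp (-6) := by
      rw [← Real.exp_log hn0, ← Real.exp_neg, ← Real.exp_add, ← Real.exp_add, hT]
      ring_nf
    have h6 : Real.exp (-6) ≤ 1 / 128 := by
      have h7 : Real.exp 6 = Real.exp 1 ^ 6 := by rw [← Real.exp_nat_mul]; norm_num
      rw [Real.exp_neg, one_div]
      apply inv_anti₀ (by norm_num)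
      rw [h7]
      calc (128 : ℝ) ≤ 2.7 ^ 6 := by norm_num
        _ ≤ _ := by
          have := Real.exp_one_gt_d9
          gcongr
          linarith
    rw [h1]
    refine h2.trans ?_
    rw [← Finset.sum_mul, h5]
    calc (∑ j, a j) * (4 * ((n : ℝ)⁻¹ * Real.exp (-6)))
        ≤ (4 * n) * (4 * ((n : ℝ)⁻¹ * (1 / 128))) := by gcongr
      _ = 1 / 8 := by field_simp; norm_num
  have he_le : ∀ η j, |e η j| ≤
      Real.exp (-T) * (Real.exp (∑ k, b j k * η k) + Real.exp (∑ k, -b j k * η k)) := by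
    intro η j
    have h1 : ∑ k, -b j k * η k = -t η j := by
      simp only [ht, neg_mul, Finset.sum_neg_distrib]
    rw [h1]
    change |t η j - max (-T) (min T (t η j))| ≤
      Real.exp (-T) * (Real.exp (t η j) + Real.exp (-t η j))
    generalize t η j = r
    rw [mul_add, ← Real.exp_add, ← Real.exp_add]
    have h2 := Real.add_one_le_exp (-T + r)
    have h3 := Real.add_one_le_exp (-T + -r)
    have h4 := Real.exp_pos (-T + r)
    have h5 := Real.exp_pos (-T + -r)
    rcases max_cases (-T) (min T r) with h | h <;> rcases min_cases T r with h' | h' <;>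
      rw [abs_le] <;> constructor <;> linarith
  have hWA : ∀ η, W η < 1 → Y η ∈ A := by
    intro η hη
    refine ⟨fun i => s * (max (-T) (min T (t η i)) + (a i)⁻¹ * ∑ j, B i j * e η j), ?_, ?_⟩
    · have hbd : ∀ i, |s * (max (-T) (min T (t η i)) + (a i)⁻¹ * ∑ j, B i j * e η j)| ≤
          s * (T + 2) := by
        intro i
        rw [abs_mul, abs_of_pos hs0]
        refine mul_le_mul_of_nonneg_left ((abs_add_le _ _).trans (add_le_add ?_ ?_)) hs0.le
        · rw [abs_le]
          exact ⟨le_max_left _ _, max_le (by linarith) (min_le_left _ _)⟩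
        · rw [abs_mul, abs_of_pos (inv_pos.2 (ha i)), inv_mul_le_iff₀ (ha i)]
          calc |∑ j, B i j * e η j| ≤ ∑ j, |B i j * e η j| := Finset.abs_sum_le_sum_abs _ _
            _ ≤ ∑ j, 2 * a i * (2 * a j * (Real.exp (-T) *
                (Real.exp (∑ k, b j k * η k) + Real.exp (∑ k, -b j k * η k)))) := by
                refine Finset.sum_le_sum fun j _ => ?_
                rw [abs_mul, ← mul_assoc (2 * a i)]
                exact mul_le_mul (hB3 i j) (he_le η j) (abs_nonneg _)
                  (by have := ha i; have := ha j; positivity)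
            _ = 2 * a i * W η := by rw [hWdef, Finset.mul_sum]
            _ ≤ a i * 2 := by nlinarith [ha i]
      exact ⟨fun i => (abs_le.1 (hbd i)).1, fun i => (abs_le.1 (hbd i)).2⟩
    · have hcoef : ∀ ζ : Fin m → ℝ, ∑ j, ζ j • v j = ∑ i, ((a i)⁻¹ * ∑ j, B i j * ζ j) • v i := by
        intro ζ
        conv_lhs => enter [2, j]; rw [← hB1 j, Finset.smul_sum]
        rw [Finset.sum_comm]
        refine Finset.sum_congr rfl fun i _ => ?_
        rw [Finset.mul_sum, Finset.sum_smul]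
        refine Finset.sum_congr rfl fun j _ => ?_
        rw [smul_smul]
        ring_nf
      have hy : ∑ i, (s * (max (-T) (min T (t η i)) + (a i)⁻¹ * ∑ j, B i j * e η j)) • v i =
          ∑ k, (g k * η k) • v k := by
        have h1 : ∑ k, (g k * η k) • v k = ∑ i, (s * t η i) • v i := by
          rw [hcoef]
          refine Finset.sum_congr rfl fun i _ => ?_
          congr 1
          simp only [ht, hb, hg, Finset.mul_sum]
          exact Finset.sum_congr rfl fun j _ => by ring
        simp_rw [h1, mul_add, add_smul, Finset.sum_add_distrib, mul_smul s]
        rw [← Finset.smul_sum, ← Finset.smul_sum, ← Finset.smul_sum, ← hcoef, ← smul_add,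
          ← Finset.sum_add_distrib]
        congr 1
        refine Finset.sum_congr rfl fun i _ => ?_
        rw [← add_smul]
        simp only [he]
        congr 1
        ring
      simp only [hYdef, hy]
  have hε : ∀ S : Finset (Fin n → ℤ), 0 ∉ S →
      ∑ w ∈ S, ‖∫ η, mFourier w (Y η) ∂stdGaussianPi m‖ ≤ 1 / 4 := by
    intro S hS
    set κ : ℝ := 4 * √n / N with hκ
    have hκ2 : κ ^ 2 = 16 * n / N ^ 2 := by
      rw [hκ, div_pow, mul_pow, Real.sq_sqrt hn0.le]
      norm_num
    let φ : (Fin n → ℤ) →+ EuclideanSpace ℝ (Fin m) := AddMonoidHom.mk'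
      (fun w => WithLp.toLp 2 fun k => κ * ((√(a k))⁻¹ * ∑ i, v k i * w i)) (by
        intro w w'
        ext k
        simp only [Pi.add_apply, Int.cast_add, mul_add, Finset.sum_add_distrib, PiLp.add_apply])
    have hφ : ∀ w, ‖φ w‖ ^ 2 = κ ^ 2 * ∑ k, (a k)⁻¹ * (∑ i, v k i * w i) ^ 2 := by
      intro w
      rw [EuclideanSpace.norm_sq_eq, Finset.mul_sum]
      refine Finset.sum_congr rfl fun k _ => ?_
      simp only [φ, AddMonoidHom.mk'_apply, Real.norm_eq_abs, sq_abs, mul_pow, inv_pow, hsq]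
    have hφ2 : ∀ w, w ≠ 0 → 2 ≤ ‖φ w‖ := by
      intro w hw
      refine le_of_sq_le_sq ?_ (norm_nonneg _)
      rw [hφ, hκ2]
      have hcs : (∑ k, |∑ i, v k i * w i|) ^ 2 ≤
          (∑ k, a k) * ∑ k, (a k)⁻¹ * (∑ i, v k i * w i) ^ 2 :=
        Finset.sum_sq_le_sum_mul_sum_of_sq_le_mul _ (fun k _ => (ha k).le)
          (fun k _ => mul_nonneg (inv_nonneg.2 (ha k).le) (sq_nonneg _)) fun k _ => by
            rw [sq_abs, mul_inv_cancel_left₀ (ha k).ne']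
      have h1 : N ^ 2 ≤ (∑ k, |∑ i, v k i * w i|) ^ 2 :=
        pow_le_pow_left₀ hN.le (hwidth w hw) 2
      have h2 : N ^ 2 ≤ 4 * n * ∑ k, (a k)⁻¹ * (∑ i, v k i * w i) ^ 2 :=
        (h1.trans hcs).trans (mul_le_mul_of_nonneg_right hasum
          (Finset.sum_nonneg fun k _ => mul_nonneg (inv_nonneg.2 (ha k).le) (sq_nonneg _)))
      rw [div_mul_eq_mul_div, le_div_iff₀ (by positivity)]
      linarith
    refine le_trans (Finset.sum_le_sum fun w _ => ?_)
      (sum_gaussian_le_quarter (by omega) φ hφ2 S hS)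
    rw [norm_integral_mFourier_gaussian g v w]
    apply Real.exp_le_exp.2
    rw [neg_le_neg_iff, hφ, hκ2]
    have h1 : ∑ k, (g k * ∑ i, v k i * w i) ^ 2 =
        s ^ 2 * ∑ k, (a k)⁻¹ * (∑ i, v k i * w i) ^ 2 := by
      rw [Finset.mul_sum]
      refine Finset.sum_congr rfl fun k _ => ?_
      simp only [hg, mul_pow, inv_pow, hsq]
      ring
    rw [h1, ← mul_assoc, ← mul_assoc]
    refine mul_le_mul_of_nonneg_right ?_ (Finset.sum_nonneg fun k _ =>
      mul_nonneg (inv_nonneg.2 (ha k).le) (sq_nonneg _))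
    have hpi : 9 ≤ Real.pi ^ 2 := by nlinarith [Real.pi_gt_three]
    calc 4 * n * (16 * n / N ^ 2) = 16 * (2 * n / N) ^ 2 := by ring
      _ ≤ 2 * Real.pi ^ 2 * s ^ 2 := by
        rw [hs]
        exact mul_le_mul_of_nonneg_right (by linarith) (sq_nonneg _)
  obtain ⟨_, ⟨τ, hτ, rfl⟩, _, ⟨σ, hσ, rfl⟩, hx⟩ :=
    exists_add_eq_of_equidistributed (stdGaussianPi m) hY hε hA hW hW0 hWA hWint
      (fun i => (x i : UnitAddCircle))
  refine ⟨fun i => τ i + σ i, fun i => ?_, ?_⟩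
  · have h1 := hτ.1 i
    have h2 := hτ.2 i
    have h3 := hσ.1 i
    have h4 := hσ.2 i
    simp only at h1 h2 h3 h4
    have h5 : T + 2 = Real.log n + 10 := by rw [hT]; ring
    rw [h5] at h1 h2 h3 h4
    rw [abs_le]
    constructor <;> linarith
  · have h : ∀ j, ∃ k : ℤ, x j - (∑ i, (τ i + σ i) • v i) j = k := by
      intro j
      have h1 := congrFun hx j
      simp only [Pi.add_apply] at h1
      rw [← AddCircle.coe_add, ← sub_eq_zero, ← AddCircle.coe_sub, AddCircle.coe_eq_zero_iff] at h1
      obtain ⟨k, hk⟩ := h1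
      refine ⟨k, ?_⟩
      simp only [add_smul, Finset.sum_add_distrib, Pi.add_apply]
      rw [← hk]
      simp
    choose k hk using h
    refine ⟨k, ?_⟩
    ext j
    rw [Pi.add_apply, ← hk j]
    ring

open Matrix in
lemma card_dotProduct_eq_zero_lt {n m : ℕ} (v : Fin m → Fin n → ℝ)
    (hv : ∀ f : Fin n → Fin m, Function.Injective f → LinearIndependent ℝ fun k => v (f k))
    {w : Fin n → ℝ} (hw : w ≠ 0) : (Finset.univ.filter fun i => v i ⬝ᵥ w = 0).card < n := by
  by_contra! h
  obtain ⟨f⟩ := Function.Embedding.nonempty_of_card_le (α := Fin n)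
    (β := {i // i ∈ Finset.univ.filter fun i => v i ⬝ᵥ w = 0}) (by
      rw [Fintype.card_fin, Fintype.card_coe]; exact h)
  have hli := hv (fun k => (f k : Fin m)) (Subtype.val_injective.comp f.injective)
  have hunit : IsUnit (Matrix.of fun k => v (f k)) := linearIndependent_rows_iff_isUnit.1 hli
  refine hw (mulVec_injective_iff_isUnit.2 hunit ?_)
  rw [mulVec_zero]
  ext k
  exact (Finset.mem_filter.1 (f k).2).2

lemma sum_smul_mem_smul_sum_segment {n m : ℕ} (v : Fin m → Fin n → ℝ) {ρ : ℝ} (hρ : 0 < ρ)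
    {θ : Fin m → ℝ} (h0 : ∀ i, 0 ≤ θ i) (h1 : ∀ i, θ i ≤ ρ) :
    ∑ i, θ i • v i ∈ ρ • ∑ i : Fin m, segment ℝ (0 : Fin n → ℝ) (v i) := by
  refine Set.mem_smul_set.2 ⟨∑ i, (θ i / ρ) • v i, ?_, ?_⟩
  · refine Set.finsetSum_mem_finsetSum _ _ _ fun i _ => ?_
    refine ⟨1 - θ i / ρ, θ i / ρ, ?_, div_nonneg (h0 i) hρ.le, by ring, by simp⟩
    rw [sub_nonneg, div_le_one hρ]
    exact h1 i
  · rw [Finset.smul_sum]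
    refine Finset.sum_congr rfl fun i _ => ?_
    rw [smul_smul, mul_div_cancel₀ _ hρ.ne']

end

/-- There is an absolute constant `c > 0` such that for all `2 ≤ n ≤ m` and every
family of `m` distinct integer vectors in `ℤ^n` in linear general position, the
lattice zonotope they generate has covering radius at most `c n log n / (m - n + 1)`. -/
theorem stmt0 :
    ∃ c : ℝ, 0 < c ∧ ∀ (n m : ℕ), 2 ≤ n → n ≤ m →
      ∀ z : Fin m → Fin n → ℤ, Function.Injective z →
      (∀ f : Fin n → Fin m, Function.Injective f →
        LinearIndependent ℝ (fun k : Fin n => fun j : Fin n => (z (f k) j : ℝ))) →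
      covRad (∑ i : Fin m, segment ℝ (0 : Fin n → ℝ) (fun j => (z i j : ℝ)))
        ≤ c * n * Real.log n / ((m : ℝ) - n + 1) := by
  refine ⟨128, by norm_num, fun n m hn hnm z _ hz => ?_⟩
  set v : Fin m → Fin n → ℝ := fun i j => (z i j : ℝ) with hv_def
  have hnm' : (n : ℝ) ≤ m := by exact_mod_cast hnm
  have hn0 : (0 : ℝ) < n := by positivity
  set N : ℝ := (m : ℝ) - n + 1 with hN_def
  have hN : 0 < N := by linarith
  have hcard := fun w (hw : w ≠ 0) => card_dotProduct_eq_zero_lt v hz (w := w) hw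
  have hspan : ∀ w, (∀ i, dotProduct (v i) w = 0) → w = 0 := by
    intro w hw
    by_contra h
    have := hcard w h
    simp only [hw, Finset.filter_true, Finset.card_univ, Fintype.card_fin] at this
    omega
  have hv0 : ∀ i, v i ≠ 0 := by
    intro i
    have hm : 0 < n := by omega
    let f : Fin n → Fin m := fun k => Equiv.swap (Fin.castLE hnm ⟨0, hm⟩) i (Fin.castLE hnm k)
    have hf : Function.Injective f :=
      (Equiv.injective _).comp (Fin.castLE_injective hnm)
    have := (hz f hf).ne_zero ⟨0, hm⟩
    simpa [f] using this
  have hwidth : ∀ w : Fin n → ℤ, w ≠ 0 → N ≤ ∑ i, |∑ j, v i j * w j| := by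
    intro w hw
    have hw' : (fun j => (w j : ℝ)) ≠ 0 := fun h => hw (by
      ext j
      simpa using congrFun h j)
    have h1 := hcard _ hw'
    have h2 := Finset.card_filter_add_card_filter_not (s := (Finset.univ : Finset (Fin m)))
      (fun i => dotProduct (v i) (fun j => (w j : ℝ)) = 0)
    rw [Finset.card_univ, Fintype.card_fin] at h2
    set P := Finset.univ.filter fun i => ¬ dotProduct (v i) (fun j => (w j : ℝ)) = 0 with hP
    have h3 : N ≤ P.card := by
      have : m + 1 ≤ P.card + n := by omega
      have : (m : ℝ) + 1 ≤ P.card + n := by exact_mod_cast this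
      linarith
    refine h3.trans ?_
    calc (P.card : ℝ) = ∑ i ∈ P, 1 := by simp
      _ ≤ ∑ i ∈ P, |∑ j, v i j * w j| := by
        refine Finset.sum_le_sum fun i hi => ?_
        have h4 : ∑ j, v i j * w j ≠ 0 := (Finset.mem_filter.1 hi).2
        have h5 : ∑ j, v i j * w j = ((∑ j, z i j * w j : ℤ) : ℝ) := by
          push_cast
          rfl
        rw [h5] at h4 ⊢
        have h6 : (∑ j, z i j * w j) ≠ 0 := by exact_mod_cast h4
        exact_mod_cast Int.one_le_abs h6
      _ ≤ _ := Finset.sum_le_sum_of_subset_of_nonneg (Finset.subset_univ _)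
        fun i _ _ => abs_nonneg _
  have hlog : 0.69 ≤ Real.log n := by
    have h2 : Real.log 2 ≤ Real.log n := Real.log_le_log (by norm_num) (by exact_mod_cast hn)
    linarith [Real.log_two_gt_d9]
  set R : ℝ := 2 * (2 * n / N * (Real.log n + 10)) with hR
  have hR0 : 0 < R := by positivity
  have hle : 2 * R ≤ 128 * n * Real.log n / N := by
    rw [hR, le_div_iff₀ hN]
    have : 2 * (2 * (2 * n / N * (Real.log n + 10))) * N = n * (8 * (Real.log n + 10)) := by
      field_simp
      ring
    rw [this, mul_comm (128 : ℝ), mul_assoc]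
    exact mul_le_mul_of_nonneg_left (by linarith) hn0.le
  refine le_trans (csInf_le ⟨0, fun ρ hρ => hρ.1.le⟩ ⟨by linarith, fun x => ?_⟩) hle
  obtain ⟨τ, hτ, k, hk⟩ :=
    exists_zonotope_add_int hn v hspan hv0 hN hwidth (x - ∑ i, R • v i)
  refine ⟨∑ i, (τ i + R) • v i, k, ?_, ?_⟩
  · exact sum_smul_mem_smul_sum_segment v (by linarith)
      (fun i => by linarith [(abs_le.1 (hτ i)).1]) fun i => by linarith [(abs_le.1 (hτ i)).2]
  · rw [sub_eq_iff_eq_add] at hk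
    rw [hk]
    simp only [add_smul, Finset.sum_add_distrib]
    abel
end

section
/- For every α ∈ ℝ^m, the set E_α = {ξ ∈ ℝ^m : l·ξ ∈ ℤ for all l ∈ Λ_α} is equal to the topological closure of the set ℤ^m + ℝα = {k + tα : k ∈ ℤ^m, t ∈ ℝ}. -/
open UnitAddTorus Filter Topology

/-- The reduction map `ℝ^d → (ℝ/ℤ)^d`. -/
def toUnitAddTorus {d : Type*} (x : d → ℝ) : UnitAddTorus d := fun i => (x i : UnitAddCircle)

lemma isOpenMap_toUnitAddTorus {d : Type*} [Finite d] :
    IsOpenMap (toUnitAddTorus : (d → ℝ) → UnitAddTorus d) :=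
  IsOpenMap.piMap (f := fun (_ : d) (x : ℝ) => (x : UnitAddCircle))
    (fun _ => QuotientAddGroup.isOpenMap_coe)
    (Eventually.of_forall fun _ => QuotientAddGroup.mk_surjective)

lemma mFourier_toUnitAddTorus {d : Type*} [Fintype d] (l : d → ℤ) (x : d → ℝ) :
    mFourier l (toUnitAddTorus x) =
      Complex.exp (2 * Real.pi * Complex.I * ((∑ i, (l i : ℝ) * x i : ℝ) : ℂ)) := by
  simp only [mFourier, ContinuousMap.coe_mk, toUnitAddTorus, fourier_coe_apply]
  rw [← Complex.exp_sum]
  push_cast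
  rw [Finset.mul_sum]
  congr 1
  refine Finset.sum_congr rfl fun i _ => ?_
  ring

lemma sum_mul_add_smul {d : Type*} [Fintype d] (l : d → ℤ) (x y : d → ℝ) (t : ℝ) :
    ∑ i, (l i : ℝ) * (x + t • y) i = ∑ i, (l i : ℝ) * x i + t * ∑ i, (l i : ℝ) * y i := by
  rw [Finset.mul_sum, ← Finset.sum_add_distrib]
  refine Finset.sum_congr rfl fun i _ => ?_
  simp only [Pi.add_apply, Pi.smul_apply, smul_eq_mul]
  ring

/-- If `l·ξ ∈ ℤ` whenever `l·α = 0`, the difference of a trigonometric polynomial along the lines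
`ξ + ℝα` and `ℝα` has no constant term, hence has a bounded primitive. -/
lemma exists_bounded_primitive_of_mem_span_mFourier {d : Type*} [Fintype d] {α ξ : d → ℝ}
    (hξ : ∀ l : d → ℤ, (∑ i, (l i : ℝ) * α i) = 0 → ∃ z : ℤ, (∑ i, (l i : ℝ) * ξ i) = (z : ℝ))
    {P : C(UnitAddTorus d, ℂ)} (hP : P ∈ Submodule.span ℂ (Set.range (mFourier (d := d)))) :
    ∃ (R : ℝ → ℂ) (C : ℝ), (∀ t, HasDerivAt R
      (P (toUnitAddTorus (ξ + t • α)) - P (toUnitAddTorus (t • α))) t) ∧ ∀ t, ‖R t‖ ≤ C := by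
  induction hP using Submodule.span_induction with
  | mem P h =>
    obtain ⟨l, rfl⟩ := h
    have hzero (t : ℝ) : toUnitAddTorus (t • α) = toUnitAddTorus (0 + t • α) := by rw [zero_add]
    simp only [hzero, mFourier_toUnitAddTorus, sum_mul_add_smul]
    simp only [Pi.zero_apply, mul_zero, Finset.sum_const_zero, zero_add]
    set a := ∑ i, (l i : ℝ) * α i with ha
    set b := ∑ i, (l i : ℝ) * ξ i with hb
    by_cases h0 : a = 0
    · obtain ⟨z, hz⟩ := hξ l h0
      refine ⟨fun _ => 0, 0, fun t => ?_, fun t => by simp⟩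
      have h1 : Complex.exp (2 * Real.pi * Complex.I * (b : ℂ)) = 1 := by
        rw [Complex.exp_eq_one_iff]
        exact ⟨z, by rw [hb, hz]; push_cast; ring⟩
      simpa [h0, h1] using hasDerivAt_const t (0 : ℂ)
    · have hc : (2 * Real.pi * Complex.I * (a : ℂ)) ≠ 0 := by
        simp [h0, Real.pi_ne_zero]
      set c := (2 * Real.pi * Complex.I * (a : ℂ)) with hcdef
      set w := (Complex.exp (2 * Real.pi * Complex.I * (b : ℂ)) - 1) / c with hw
      refine ⟨fun t => w * Complex.exp (c * (t : ℂ)), ‖w‖, fun t => ?_, fun t => ?_⟩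
      · have h1 : HasDerivAt (fun t : ℝ => c * (t : ℂ)) (c * 1) t :=
          (Complex.ofRealCLM.hasDerivAt (x := t)).const_mul c
        refine (h1.cexp.const_mul w).congr_deriv ?_
        have h2 : 2 * (Real.pi : ℂ) * Complex.I * ((b + t * a : ℝ) : ℂ)
            = 2 * Real.pi * Complex.I * (b : ℂ) + c * t := by
          rw [hcdef]; push_cast; ring
        have h3 : 2 * (Real.pi : ℂ) * Complex.I * ((t * a : ℝ) : ℂ) = c * t := by
          rw [hcdef]; push_cast; ring
        rw [h2, h3, Complex.exp_add, hw]
        field_simp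
      · have h3 : c * (t : ℂ) = ((2 * Real.pi * a * t : ℝ) : ℂ) * Complex.I := by
          rw [hcdef]; push_cast; ring
        rw [norm_mul, h3, Complex.norm_exp_ofReal_mul_I, mul_one]
  | zero => exact ⟨fun _ => 0, 0, fun t => by simpa using hasDerivAt_const t (0 : ℂ), by simp⟩
  | add P Q _ _ hP hQ =>
    obtain ⟨R, C, hR, hC⟩ := hP
    obtain ⟨S, D, hS, hD⟩ := hQ
    refine ⟨R + S, C + D, fun t => ((hR t).add (hS t)).congr_deriv ?_,
      fun t => (norm_add_le _ _).trans (add_le_add (hC t) (hD t))⟩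
    simp only [ContinuousMap.add_apply]
    ring
  | smul c P _ hP =>
    obtain ⟨R, C, hR, hC⟩ := hP
    refine ⟨fun t => c * R t, ‖c‖ * C, fun t => ((hR t).const_mul c).congr_deriv ?_, fun t => ?_⟩
    · simp only [ContinuousMap.smul_apply, smul_eq_mul]
      ring
    · rw [norm_mul]
      exact mul_le_mul_of_nonneg_left (hC t) (norm_nonneg c)

/-- A real function with a bounded primitive is not bounded below by a positive constant. -/
lemma not_forall_le_of_bounded_primitive {f g : ℝ → ℝ} {δ C : ℝ} (hδ : 0 < δ)
    (hf : ∀ t, HasDerivAt f (g t) t) (hC : ∀ t, |f t| ≤ C) : ¬ ∀ t, δ ≤ g t := by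
  intro hg
  have hC0 : 0 ≤ C := (abs_nonneg _).trans (hC 0)
  have hT : (0 : ℝ) ≤ (2 * C + 1) / δ := by positivity
  have h := mul_sub_le_image_sub_of_le_deriv (fun t => (hf t).differentiableAt)
    (fun t => (hg t).trans_eq (hf t).deriv.symm) hT
  rw [sub_zero, mul_div_cancel₀ _ hδ.ne'] at h
  linarith [abs_le.mp (hC 0), abs_le.mp (hC ((2 * C + 1) / δ))]

/-- Kronecker's theorem on the torus: a point annihilated by all characters that annihilate a
one-parameter subgroup lies in the closure of that subgroup. -/
lemma toUnitAddTorus_mem_closure_range {d : Type*} [Fintype d] {α ξ : d → ℝ}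
    (hξ : ∀ l : d → ℤ, (∑ i, (l i : ℝ) * α i) = 0 → ∃ z : ℤ, (∑ i, (l i : ℝ) * ξ i) = (z : ℝ)) :
    toUnitAddTorus ξ ∈ closure (Set.range fun t : ℝ => toUnitAddTorus (t • α)) := by
  set H := Set.range fun t : ℝ => toUnitAddTorus (t • α) with hH
  have hne : H.Nonempty := Set.range_nonempty _
  by_contra hmem
  rw [Metric.infDist_pos_iff_notMem_closure hne] at hmem
  set δ := Metric.infDist (toUnitAddTorus ξ) H
  have hshift (t : ℝ) : δ ≤ Metric.infDist (toUnitAddTorus (ξ + t • α)) H := by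
    refine (Metric.le_infDist hne).mpr ?_
    rintro _ ⟨s, rfl⟩
    have h1 : dist (toUnitAddTorus (ξ + t • α)) (toUnitAddTorus (s • α))
        = dist (toUnitAddTorus ξ) (toUnitAddTorus ((s - t) • α)) := by
      rw [dist_eq_norm, dist_eq_norm]
      congr 1
      funext i
      simp only [toUnitAddTorus, Pi.sub_apply, Pi.add_apply, Pi.smul_apply, smul_eq_mul]
      rw [← AddCircle.coe_sub, ← AddCircle.coe_sub]
      congr 1
      ring
    rw [h1]
    exact Metric.infDist_le_dist_of_mem ⟨s - t, rfl⟩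
  let f : C(UnitAddTorus d, ℂ) :=
    ⟨fun x => (Metric.infDist x H : ℂ),
      Complex.continuous_ofReal.comp (Metric.continuous_infDist_pt H)⟩
  have hf : f ∈ (Submodule.span ℂ (Set.range (mFourier (d := d)))).topologicalClosure := by
    rw [span_mFourier_closure_eq_top]
    trivial
  obtain ⟨P, hP, hfP⟩ := Metric.mem_closure_iff.mp hf (δ / 3) (by positivity)
  have happrox (x : UnitAddTorus d) : |Metric.infDist x H - (P x).re| ≤ δ / 3 := by
    have h1 : ‖f x - P x‖ ≤ δ / 3 :=
      (dist_eq_norm (f x) (P x)).symm.trans_le ((ContinuousMap.dist_apply_le_dist x).trans hfP.le)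
    simpa [f] using (Complex.abs_re_le_norm _).trans h1
  obtain ⟨R, C, hR, hC⟩ := exists_bounded_primitive_of_mem_span_mFourier hξ hP
  refine not_forall_le_of_bounded_primitive (f := fun t => (R t).re) (div_pos hmem three_pos)
    (fun t => Complex.reCLM.hasFDerivAt.comp_hasDerivAt t (hR t))
    (fun t => (Complex.abs_re_le_norm _).trans (hC t)) fun t => ?_
  have h1 := abs_le.mp (happrox (toUnitAddTorus (ξ + t • α)))
  have h2 := abs_le.mp (happrox (toUnitAddTorus (t • α)))
  have h3 : Metric.infDist (toUnitAddTorus (t • α)) H = 0 := Metric.infDist_zero_of_mem ⟨t, rfl⟩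
  have h4 := hshift t
  simp only [Complex.reCLM_apply, Complex.sub_re]
  linarith

/-- For every `α ∈ ℝ^m`, the set `E_α = {ξ : l·ξ ∈ ℤ for all l ∈ Λ_α}` equals the
topological closure of `ℤ^m + ℝα`. -/
theorem stmt2 (m : ℕ) (α : Fin m → ℝ) :
    {ξ : Fin m → ℝ | ∀ l : Fin m → ℤ, (∑ i, (l i : ℝ) * α i) = 0 →
      ∃ z : ℤ, (∑ i, (l i : ℝ) * ξ i) = (z : ℝ)}
    = closure {x : Fin m → ℝ |
        ∃ (k : Fin m → ℤ) (t : ℝ), x = (fun i => (k i : ℝ)) + t • α} := by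
  refine Set.Subset.antisymm (fun ξ hξ => ?_) (closure_minimal ?_ ?_)
  · have h := isOpenMap_toUnitAddTorus.preimage_closure_subset_closure_preimage
      (toUnitAddTorus_mem_closure_range hξ)
    refine closure_mono ?_ h
    rintro x ⟨t, ht⟩
    have hk (i : Fin m) : ∃ k : ℤ, x i = k + t * α i := by
      have hi : ((t * α i : ℝ) : UnitAddCircle) = (x i : ℝ) := congrFun ht i
      rw [eq_comm, ← sub_eq_zero, ← AddCircle.coe_sub, AddCircle.coe_eq_zero_iff] at hi
      obtain ⟨k, hk⟩ := hi
      exact ⟨k, by rw [zsmul_one] at hk; linarith⟩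
    choose k hk using hk
    exact ⟨k, t, funext fun i => by simp [hk i]⟩
  · rintro _ ⟨k, t, rfl⟩ l hl
    refine ⟨∑ i, l i * k i, ?_⟩
    rw [sum_mul_add_smul, hl]
    push_cast
    ring
  · simp only [Set.ofPred_forall]
    refine isClosed_iInter fun l => isClosed_iInter fun _ => ?_
    have hcont : Continuous fun ξ : Fin m → ℝ => ∑ i, (l i : ℝ) * ξ i := by fun_prop
    convert Real.isClosed_range_intCast.preimage hcont using 1
    ext ξ
    simp [eq_comm]
end

section
/- Let α ∈ ℝ^m be a vector whose coordinates α_1, …, α_m are linearly independent over ℚ. Then the set ℤ^m + ℝα = {k + tα : k ∈ ℤ^m, t ∈ ℝ} is dense in ℝ^m. -/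
open MeasureTheory in
/-- A translation-invariant integral kills every continuous function that is multiplied by a
constant other than `1` under some translation. -/
theorem integral_eq_zero_of_add_left_eq_mul {G : Type*} [AddGroup G] [MeasurableSpace G]
    [MeasurableAdd G] (ν : Measure G) [ν.IsAddLeftInvariant] {χ : G → ℂ} {g : G} {c : ℂ}
    (hc : c ≠ 1) (hχ : ∀ x, χ (g + x) = c * χ x) : ∫ x, χ x ∂ν = 0 := by
  have h : c * ∫ x, χ x ∂ν = ∫ x, χ x ∂ν := by
    rw [← integral_const_mul, ← integral_add_left_eq_self χ g]
    simp_rw [hχ]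
  have h' : (c - 1) * ∫ x, χ x ∂ν = 0 := by rw [sub_mul, h, one_mul, sub_self]
  exact (mul_eq_zero.mp h').resolve_left (sub_ne_zero.mpr hc)

namespace UnitAddTorus

variable {d : Type*} [Fintype d]

theorem mFourier_apply_add (n : d → ℤ) (x y : UnitAddTorus d) :
    mFourier n (x + y) = mFourier n x * mFourier n y := by
  simp [mFourier, fourier_apply, smul_add, AddCircle.toCircle_add, Finset.prod_mul_distrib]

theorem mFourier_apply_coe (n : d → ℤ) (x : d → ℝ) :
    mFourier n (fun i => (x i : UnitAddCircle)) =
      Complex.exp (2 * Real.pi * Complex.I * ((∑ i, n i * x i : ℝ) : ℂ)) := by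
  simp only [mFourier, ContinuousMap.coe_mk, fourier_coe_apply, ← Complex.exp_sum]
  congr 1
  push_cast
  rw [Finset.mul_sum]
  refine Finset.sum_congr rfl fun i _ => ?_
  simp only [div_one]
  ring

open MeasureTheory in
/-- A closed subgroup of the torus on which no nontrivial character is trivial is the whole
torus. -/
theorem eq_top_of_isClosed_of_mFourier_ne_one (H : AddSubgroup (UnitAddTorus d))
    (hH : IsClosed (H : Set (UnitAddTorus d)))
    (hn : ∀ n : d → ℤ, n ≠ 0 → ∃ h ∈ H, mFourier n h ≠ 1) : H = ⊤ := by
  rw [AddSubgroup.eq_top_iff']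
  by_contra! hx
  obtain ⟨x₀, hx₀⟩ := hx
  have : CompactSpace H := isCompact_iff_compactSpace.mp hH.isCompact
  let : MeasurableSpace H := borel H
  have : BorelSpace H := ⟨rfl⟩
  let ν : Measure H := Measure.addHaarMeasure ⊤
  have : IsProbabilityMeasure ν := ⟨Measure.addHaarMeasure_self⟩
  have hint : ∀ f : H → ℂ, Continuous f → Integrable f ν := fun f hf =>
    hf.integrable_of_hasCompactSupport (HasCompactSupport.of_compactSpace f)
  have hintP : ∀ P : C(UnitAddTorus d, ℂ), Integrable (fun h : H => P (x₀ + h) - P h) ν :=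
    fun P => hint _ (by fun_prop)
  have hspan : ∀ P ∈ Submodule.span ℂ (Set.range (mFourier (d := d))),
      ∫ h : H, (P (x₀ + h) - P h) ∂ν = 0 := by
    intro P hP
    induction hP using Submodule.span_induction with
    | mem P hP =>
      obtain ⟨n, rfl⟩ := hP
      rcases eq_or_ne n 0 with rfl | hn0
      · simp [mFourier_zero]
      · obtain ⟨g, hg, hg1⟩ := hn n hn0
        refine integral_eq_zero_of_add_left_eq_mul ν (g := ⟨g, hg⟩) hg1 fun h => ?_
        simp only [AddSubgroup.coe_add, mFourier_apply_add]
        ring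
    | zero => simp
    | add P Q _ _ hP hQ =>
      rw [← add_zero (0 : ℂ)]
      nth_rw 1 [← hP]
      rw [← hQ, ← integral_add (hintP P) (hintP Q)]
      congr 1 with h
      simp only [ContinuousMap.add_apply]
      ring
    | smul c P _ hP =>
      simp only [ContinuousMap.smul_apply, ← smul_sub, integral_smul, hP, smul_zero]
  have hdisj : Disjoint (H : Set (UnitAddTorus d)) ((fun x => x - x₀) ⁻¹' H) := by
    rw [Set.disjoint_left]
    intro y hy hy'
    exact hx₀ (by simpa using H.sub_mem hy hy')
  obtain ⟨f, hf0, hf1, -⟩ := exists_continuous_zero_one_of_isClosed hH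
    (hH.preimage (continuous_id.sub continuous_const)) hdisj
  let F : C(UnitAddTorus d, ℂ) := ⟨fun x => (f x : ℂ), by fun_prop⟩
  have hF : F ∈ closure (Submodule.span ℂ (Set.range (mFourier (d := d))) : Set _) := by
    rw [← Submodule.topologicalClosure_coe, span_mFourier_closure_eq_top]
    trivial
  obtain ⟨P, hP, hPF⟩ := Metric.mem_closure_iff.mp hF (1 / 4) (by norm_num)
  have hdist : ∀ x, ‖P x - F x‖ ≤ 1 / 4 := fun x => by
    rw [← dist_eq_norm, dist_comm]
    exact (ContinuousMap.dist_apply_le_dist x).trans hPF.le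
  have hle : ‖∫ h : H, ((P (x₀ + h) - P h) - 1) ∂ν‖ ≤ 1 / 2 * ν.real Set.univ := by
    refine norm_integral_le_of_norm_le_const (.of_forall fun h => ?_)
    have e0 : F h = 0 := by simpa [F] using hf0 h.2
    have e1 : F (x₀ + h) = 1 := by
      have : f (x₀ + h) = 1 := hf1 (by simp)
      simp [F, this]
    calc ‖P (x₀ + h) - P h - 1‖ = ‖(P (x₀ + h) - F (x₀ + h)) - (P h - F h)‖ := by
          rw [e0, e1]; congr 1; ring
      _ ≤ 1 / 4 + 1 / 4 := (norm_sub_le _ _).trans (add_le_add (hdist _) (hdist _))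
      _ = 1 / 2 := by norm_num
  rw [integral_sub (hintP P) (integrable_const _), hspan P hP] at hle
  norm_num at hle

/-- **Kronecker's theorem**: a one-parameter subgroup of the torus whose direction has rationally
independent coordinates is dense. -/
theorem denseRange_coe_smul {α : d → ℝ} (hα : LinearIndependent ℚ α) :
    DenseRange fun (t : ℝ) (i : d) => ((t * α i : ℝ) : UnitAddCircle) := by
  let φ : ℝ →+ UnitAddTorus d :=
    { toFun t i := ((t * α i : ℝ) : UnitAddCircle)
      map_zero' := by ext i; simp
      map_add' s t := by ext i; simp [add_mul] }
  have htop : φ.range.topologicalClosure = ⊤ := by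
    refine eq_top_of_isClosed_of_mFourier_ne_one _ φ.range.isClosed_topologicalClosure
      fun n hn => ?_
    have hs : ∑ i, (n i : ℝ) * α i ≠ 0 := by
      intro h0
      refine hn (funext fun i => ?_)
      have := Fintype.linearIndependent_iff.mp hα (fun i => (n i : ℚ))
        (by simpa [Rat.smul_def] using h0) i
      exact_mod_cast this
    set s := ∑ i, (n i : ℝ) * α i with hsdef
    refine ⟨φ (1 / (2 * s)), φ.range.le_topologicalClosure ⟨_, rfl⟩, ?_⟩
    have harg : ∑ i, (n i : ℝ) * (1 / (2 * s) * α i) = 1 / 2 := by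
      simp_rw [mul_left_comm (_ : ℝ) (1 / (2 * s)), ← Finset.mul_sum, ← hsdef]
      field_simp
    have hval : mFourier n (φ (1 / (2 * s))) = -1 := by
      refine (mFourier_apply_coe n fun i => 1 / (2 * s) * α i).trans ?_
      rw [harg, ← Complex.exp_pi_mul_I]
      congr 1
      push_cast
      ring
    rw [hval]
    norm_num
  have hclosure := congrArg (fun K : AddSubgroup (UnitAddTorus d) => (K : Set (UnitAddTorus d))) htop
  rw [AddSubgroup.topologicalClosure_coe, AddMonoidHom.coe_range, AddSubgroup.coe_top] at hclosure
  exact dense_iff_closure_eq.mpr hclosure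

end UnitAddTorus

/-- If the coordinates of `α ∈ ℝ^m` are linearly independent over `ℚ`, then the set
`ℤ^m + ℝα` is dense in `ℝ^m`. -/
theorem stmt3 (m : ℕ) (α : Fin m → ℝ) (hα : LinearIndependent ℚ α) :
    Dense {x : Fin m → ℝ |
      ∃ (k : Fin m → ℤ) (t : ℝ), x = (fun i => (k i : ℝ)) + t • α} := by
  have hopen : IsOpenMap (Pi.map fun (_ : Fin m) (x : ℝ) => (x : UnitAddCircle)) :=
    IsOpenMap.piMap (fun _ => QuotientAddGroup.isOpenMap_coe)
      (Filter.Eventually.of_forall fun _ => QuotientAddGroup.mk_surjective)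
  refine ((UnitAddTorus.denseRange_coe_smul hα).preimage hopen).mono ?_
  rintro x ⟨t, ht⟩
  have hk : ∀ i, ∃ k : ℤ, (k : ℝ) = x i - t * α i := by
    intro i
    have hi : ((x i - t * α i : ℝ) : UnitAddCircle) = 0 := by
      rw [AddCircle.coe_sub, sub_eq_zero]
      exact (congrFun ht i).symm
    simpa using (AddCircle.coe_eq_zero_iff (1 : ℝ)).mp hi
  choose k hk using hk
  exact ⟨k, t, funext fun i => by simp [hk]⟩
end

section
/- Let α ∈ ℤ^m have all coordinates positive with gcd(α_1, …, α_m) = 1, and let a_1, …, a_{m−1} ∈ ℤ^m be a ℤ-basis of the lattice Λ_α = {l ∈ ℤ^m : l·α = 0}. Let A be the (m−1)×m integer matrix whose rows are a_1^T, …, a_{m−1}^T. Then for every i ∈ {1, …, m}, α_i equals the absolute value of the determinant of the (m−1)×(m−1) matrix obtained from A by deleting its i-th column; equivalently, α_i is the (m−1)-dimensional volume of the parallelepiped spanned by the columns of A other than column i. -/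
/-- Every row of `1 - α uᵀ` is orthogonal to `α` when `u · α = 1`; so if the rows `a` span the
lattice orthogonal to `α`, then adjoining `u` to `a` gives a unimodular matrix. -/
theorem isUnit_det_cons_of_span_orthogonal {m : ℕ} {α u : Fin (m + 1) → ℤ}
    {a : Fin m → Fin (m + 1) → ℤ} (hu : ∑ j, u j * α j = 1)
    (hspan : ∀ l : Fin (m + 1) → ℤ, (∑ j, l j * α j) = 0 → ∃ c : Fin m → ℤ, l = ∑ i, c i • a i) :
    IsUnit (Matrix.of (Fin.cons u a : Fin (m + 1) → Fin (m + 1) → ℤ)).det := by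
  have horth : ∀ k, (∑ j, ((Pi.single k 1 : Fin (m + 1) → ℤ) - α k • u) j * α j) = 0 := by
    intro k
    simp [sub_mul, Finset.sum_sub_distrib, mul_assoc, ← Finset.mul_sum, hu, Pi.single_apply]
  choose c hc using fun k => hspan _ (horth k)
  refine Matrix.isUnit_det_of_left_inverse
    (B := Matrix.of fun k => (Fin.cons (α k) (c k) : Fin (m + 1) → ℤ)) ?_
  ext k j
  have h := congrFun (hc k) j
  simp only [Pi.sub_apply, Pi.smul_apply, smul_eq_mul, Finset.sum_apply] at h
  rw [Matrix.mul_apply, Fin.sum_univ_succ, Matrix.one_eq_pi_single]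
  simp only [Matrix.of_apply, Fin.cons_zero, Fin.cons_succ]
  linarith

/-- Let `α ∈ ℤ^{m+1}` have positive coordinates with gcd `1`, and let
`a_1, …, a_m` be a `ℤ`-basis of `Λ_α = {l ∈ ℤ^{m+1} : l·α = 0}`, collected as the
rows of a matrix `A`. Then for every `i`, `α_i` equals the absolute value of the
determinant of the square matrix obtained from `A` by deleting column `i`. -/
theorem stmt6 (m : ℕ) (α : Fin (m + 1) → ℤ) (hpos : ∀ i, 0 < α i)
    (hgcd : Finset.univ.gcd α = 1)
    (a : Fin m → Fin (m + 1) → ℤ)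
    (hmem : ∀ i, (∑ j, a i j * α j) = 0)
    (hbasis : ∀ l : Fin (m + 1) → ℤ, (∑ j, l j * α j) = 0 →
      ∃! c : Fin m → ℤ, l = ∑ i, c i • a i) :
    ∀ i : Fin (m + 1),
      α i = |(Matrix.of (fun (r : Fin m) (c : Fin m) => a r (i.succAbove c))).det| := by
  obtain ⟨u, hu⟩ := Finset.gcd_eq_sum_mul Finset.univ α
  replace hu : ∑ j, u j * α j = 1 := by
    rw [← hgcd, hu]
    exact Finset.sum_congr rfl fun j _ => mul_comm _ _
  intro i
  set B : Matrix (Fin (m + 1)) (Fin (m + 1)) ℤ :=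
    Matrix.of (Fin.cons u a : Fin (m + 1) → Fin (m + 1) → ℤ) with hB
  have hdet : IsUnit B.det :=
    isUnit_det_cons_of_span_orthogonal hu fun l hl => (hbasis l hl).exists
  have hBα : B.mulVec α = Pi.single 0 1 := by
    ext k
    refine Fin.cases ?_ (fun k => ?_) k
    · simpa [hB, Matrix.mulVec, dotProduct] using hu
    · simpa [hB, Matrix.mulVec, dotProduct] using hmem k
  have hadj : B.det * α i = B.adjugate i 0 := by
    have h := congrArg (fun v => B.adjugate.mulVec v i) hBα
    simpa [Matrix.mulVec_mulVec, Matrix.adjugate_mul, Matrix.smul_mulVec] using h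
  have hminor : B.submatrix (Fin.succAbove 0) i.succAbove =
      Matrix.of (fun (r : Fin m) (c : Fin m) => a r (i.succAbove c)) := by
    ext r c
    simp [hB]
  rw [Matrix.adjugate_fin_succ_eq_det_submatrix, hminor] at hadj
  have habs := congrArg abs hadj
  rwa [abs_mul, abs_mul, abs_pow, abs_neg, abs_one, one_pow, one_mul,
    Int.isUnit_iff_abs_eq.mp hdet, one_mul, abs_of_pos (hpos i)] at habs
end

section
/- For every α ∈ ℝ^m, the dimension of the ℚ-vector subspace of ℝ spanned by the coordinates α_1, …, α_m equals m − dim_ℝ(V_α), where V_α is the ℝ-linear span of Λ_α = {l ∈ ℤ^m : l·α = 0}. -/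
/-- Over a field extension `L / K`, the `L`-span of the coordinatewise image of a `K`-subspace
of `ι → K` has the same dimension as that subspace. -/
theorem finrank_span_image_algebraMap_comp {K L ι : Type*} [Field K] [Field L] [Algebra K L]
    [Fintype ι] (W : Submodule K (ι → K)) :
    Module.finrank L (Submodule.span L ((fun v : ι → K => algebraMap K L ∘ v) '' W)) =
      Module.finrank K W := by
  let c : (ι → K) →ₗ[K] (ι → L) := (Algebra.linearMap K L).compLeft ι
  let b := Module.finBasis K W
  have hb : LinearIndependent K fun i => (b i : ι → K) :=
    b.linearIndependent.map' W.subtype W.ker_subtype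
  have hL : LinearIndependent L fun i => c (b i) :=
    linearIndependent_algebraMap_comp_iff.mpr hb
  have hspan : Submodule.span L ((fun v : ι → K => algebraMap K L ∘ v) '' W) =
      Submodule.span L (Set.range fun i => c (b i)) := by
    apply le_antisymm
    · rw [Submodule.span_le]
      rintro _ ⟨v, hv, rfl⟩
      have h : c v = ∑ i, b.repr ⟨v, hv⟩ i • c (b i) := by
        have := congrArg (c ∘ₗ W.subtype) (b.sum_repr ⟨v, hv⟩)
        simpa only [map_sum, map_smul, LinearMap.comp_apply, Submodule.subtype_apply]
          using this.symm
      change c v ∈ _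
      rw [h]
      refine Submodule.sum_mem _ fun i _ => ?_
      rw [← algebraMap_smul L]
      exact Submodule.smul_mem _ _ (Submodule.subset_span ⟨i, rfl⟩)
    · refine Submodule.span_mono ?_
      rintro _ ⟨i, rfl⟩
      exact ⟨b i, (b i).2, rfl⟩
  rw [hspan, finrank_span_eq_card hL, Fintype.card_fin]

/-- The integer relations among the coordinates of `α` span the same real subspace as the
rational ones. -/
theorem span_integer_relations_eq {ι : Type*} [Fintype ι] (α : ι → ℝ) :
    Submodule.span ℝ {v : ι → ℝ |
        ∃ l : ι → ℤ, v = (fun i => (l i : ℝ)) ∧ (∑ i, (l i : ℝ) * α i) = 0} =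
      Submodule.span ℝ ((fun v : ι → ℚ => algebraMap ℚ ℝ ∘ v) ''
        LinearMap.ker (Fintype.linearCombination ℚ α)) := by
  apply le_antisymm
  · refine Submodule.span_mono ?_
    rintro _ ⟨l, rfl, hl⟩
    refine ⟨fun i => l i, ?_, ?_⟩
    · simpa [Fintype.linearCombination_apply, Rat.smul_def] using hl
    · ext i
      simp
  · rw [Submodule.span_le]
    rintro _ ⟨q, hq, rfl⟩
    obtain ⟨d, hd⟩ := IsLocalization.exist_integer_multiples_of_finite (nonZeroDivisors ℤ) q
    choose l hl using hd
    have hd0 : ((d : ℤ) : ℝ) ≠ 0 := by exact_mod_cast nonZeroDivisors.coe_ne_zero d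
    have hlq (i : ι) : (l i : ℝ) = (d : ℤ) * (q i : ℝ) := by
      have := hl i
      simp only [algebraMap_int_eq, eq_intCast, zsmul_eq_mul] at this
      exact_mod_cast this
    have hq' : ∑ i, (q i : ℝ) * α i = 0 := by
      simpa [Fintype.linearCombination_apply, Rat.smul_def] using hq
    have h : algebraMap ℚ ℝ ∘ q = ((d : ℤ) : ℝ)⁻¹ • fun i => (l i : ℝ) := by
      ext i
      simp [hlq, hd0]
    change algebraMap ℚ ℝ ∘ q ∈ _
    rw [h]
    refine Submodule.smul_mem _ _ (Submodule.subset_span ⟨l, rfl, ?_⟩)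
    simp only [hlq, mul_assoc, ← Finset.mul_sum, hq', mul_zero]


/-- For every `α ∈ ℝ^m`, the dimension of the `ℚ`-vector space spanned by the
coordinates of `α` equals `m - dim_ℝ V_α`, where `V_α` is the real span of
`Λ_α = {l ∈ ℤ^m : l·α = 0}`. -/
theorem stmt8 (m : ℕ) (α : Fin m → ℝ) :
    Module.finrank ℚ (Submodule.span ℚ (Set.range α)) =
      m - Module.finrank ℝ (Submodule.span ℝ {v : Fin m → ℝ |
        ∃ l : Fin m → ℤ, v = (fun i => (l i : ℝ)) ∧ (∑ i, (l i : ℝ) * α i) = 0}) := by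
  rw [span_integer_relations_eq, finrank_span_image_algebraMap_comp,
    ← Fintype.range_linearCombination]
  have h := (Fintype.linearCombination ℚ α).finrank_range_add_finrank_ker
  rw [Module.finrank_fin_fun] at h
  omega
end

section
/- Let α ∈ ℝ^m, let a_1, …, a_n ∈ ℤ^m be a ℤ-basis of the lattice Λ_α = {l ∈ ℤ^m : l·α = 0}, and let A be the n×m matrix whose i-th row is a_i^T. Then for every subset I ⊆ {1, …, m} with |I| = n, the determinant of the n×n submatrix A_I formed by the columns of A indexed by I is nonzero if and only if the m − n coordinates of α indexed by the complement I^c are linearly independent over ℚ (equivalently, the ℚ-vector space spanned by (α_i)_{i ∈ I^c} has dimension m − n). -/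
/-- Let `α ∈ ℝ^m`, let `a_1, …, a_n` be a `ℤ`-basis of `Λ_α = {l ∈ ℤ^m : l·α = 0}`,
and `A` the `n×m` matrix with rows the `a_i`. For a size-`n` index set `I` (given by
an injection `f`, with complement given by `fc`), the determinant of the submatrix
`A_I` is nonzero iff the coordinates of `α` indexed by `I^c` are linearly
independent over `ℚ`. -/
theorem stmt9 (m n : ℕ) (hnm : n ≤ m) (α : Fin m → ℝ)
    (a : Fin n → Fin m → ℤ)
    (hmem : ∀ i, (∑ j, (a i j : ℝ) * α j) = 0)
    (hbasis : ∀ l : Fin m → ℤ, (∑ j, (l j : ℝ) * α j) = 0 →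
      ∃! c : Fin n → ℤ, l = ∑ i, c i • a i)
    (f : Fin n → Fin m) (fc : Fin (m - n) → Fin m)
    (hf : Function.Injective f) (hfc : Function.Injective fc)
    (hdisj : ∀ i j, f i ≠ fc j) :
    (Matrix.of (fun (i : Fin n) (j : Fin n) => (a i (f j) : ℝ))).det ≠ 0 ↔
      LinearIndependent ℚ (fun i : Fin (m - n) => α (fc i)) := by
  have hbij : Function.Bijective (Sum.elim f fc) := by
    rw [Fintype.bijective_iff_injective_and_card]
    refine ⟨hf.sumElim hfc hdisj, ?_⟩
    simp only [Fintype.card_sum, Fintype.card_fin]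
    omega
  let e : Fin n ⊕ Fin (m - n) ≃ Fin m := Equiv.ofBijective _ hbij
  have hsplit (g : Fin m → ℝ) : ∑ j, g j = ∑ i, g (f i) + ∑ i, g (fc i) := by
    rw [← e.sum_comp, Fintype.sum_sum_type]
    rfl
  have hext (l : Fin m → ℤ) (h₁ : ∀ i, l (f i) = 0) (h₂ : ∀ i, l (fc i) = 0) : l = 0 := by
    funext j
    obtain ⟨i | i, rfl⟩ := hbij.surjective j
    · exact h₁ i
    · exact h₂ i
  have hcomb (c : Fin n → ℤ) : ∑ j, (((∑ i, c i • a i) j : ℤ) : ℝ) * α j = 0 := by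
    simp only [Finset.sum_apply, Pi.smul_apply, smul_eq_mul, Int.cast_sum, Int.cast_mul,
      Finset.sum_mul]
    rw [Finset.sum_comm]
    refine Finset.sum_eq_zero fun i _ => ?_
    simp only [mul_assoc, ← Finset.mul_sum, hmem, mul_zero]
  have hzero (c : Fin n → ℤ) (hc : ∑ i, c i • a i = 0) : c = 0 :=
    (hbasis 0 (by simp)).unique hc.symm (by simp)
  let B : Matrix (Fin n) (Fin n) ℤ := Matrix.of fun i j => a i (f j)
  have hvec (c : Fin n → ℤ) (j : Fin n) : (Matrix.vecMul c B) j = (∑ i, c i • a i) (f j) := by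
    simp [B, Matrix.vecMul, dotProduct]
  have hdet : (Matrix.of (fun (i : Fin n) (j : Fin n) => (a i (f j) : ℝ))).det = (B.det : ℝ) :=
    (Int.cast_det B).symm
  rw [hdet, Int.cast_ne_zero, ← LinearIndependent.iff_fractionRing ℤ ℚ,
    Fintype.linearIndependent_iff]
  simp only [zsmul_eq_mul]
  constructor
  · intro hB g hg
    let l : Fin m → ℤ := fun j => Sum.elim 0 g (e.symm j)
    have hlf (i : Fin n) : l (f i) = 0 := by
      simp [l, show e.symm (f i) = Sum.inl i from e.symm_apply_apply (Sum.inl i)]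
    have hlfc (i : Fin (m - n)) : l (fc i) = g i := by
      simp [l, show e.symm (fc i) = Sum.inr i from e.symm_apply_apply (Sum.inr i)]
    obtain ⟨c, hc, -⟩ := hbasis l (by simp [hsplit, hlf, hlfc, hg])
    have hc₀ : c = 0 := by
      refine Matrix.eq_zero_of_vecMul_eq_zero hB (funext fun j => ?_)
      rw [hvec, ← hc, hlf, Pi.zero_apply]
    intro i
    rw [← hlfc, hc, hc₀]
    simp
  · intro hli hB
    obtain ⟨c, hc, hcB⟩ := Matrix.exists_vecMul_eq_zero_iff.mpr hB
    have hlf (j : Fin n) : (∑ i, c i • a i) (f j) = 0 := by rw [← hvec, hcB, Pi.zero_apply]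
    have hsum := hcomb c
    rw [hsplit] at hsum
    simp only [hlf, Int.cast_zero, zero_mul, Finset.sum_const_zero, zero_add] at hsum
    exact hc (hzero c (hext _ hlf (hli _ hsum)))
end

section
/- Let α ∈ ℝ^m with dim_ℚ(α) = m − n, let a_1, …, a_n ∈ ℤ^m be a ℤ-basis of Λ_α = {l ∈ ℤ^m : l·α = 0}, and let A be the n×m matrix whose i-th row is a_i^T. Then α is rationally uniform (i.e., every m − n of the coordinates α_1, …, α_m are linearly independent over ℚ) if and only if the m columns of A are in linear general position in ℝ^n (i.e., every n of the columns of A are linearly independent over ℝ). -/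
/-- An injective map from `Fin n` to `Fin m` has a complementary injective map from
`Fin k`, where `k + n = m`. -/
lemma exists_injective_range_eq_compl {m n k : ℕ} (hk : k + n = m) (f : Fin n → Fin m)
    (hf : Function.Injective f) :
    ∃ g : Fin k → Fin m, Function.Injective g ∧ Set.range g = (Set.range f)ᶜ := by
  classical
  have hcard : ((Finset.univ.image f)ᶜ).card = k := by
    rw [Finset.card_compl, Finset.card_image_of_injective _ hf]
    simp
    omega
  refine ⟨(Finset.univ.image f)ᶜ.orderEmbOfFin hcard, RelEmbedding.injective _, ?_⟩
  rw [Finset.range_orderEmbOfFin]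
  simp

/-- The rows of an integer matrix, viewed over `ℝ`, are linearly independent iff the
matrix has trivial kernel. -/
lemma linearIndependent_intCast_iff_mulVec {n : ℕ} (N : Matrix (Fin n) (Fin n) ℤ) :
    LinearIndependent ℝ (fun j i => (N j i : ℝ)) ↔ ∀ v, N.mulVec v = 0 → v = 0 := by
  have hdet : (N.map (Int.castRingHom ℝ)).det = (N.det : ℝ) :=
    ((Int.castRingHom ℝ).map_det N).symm
  have hrow : LinearIndependent ℝ (fun j i => (N j i : ℝ)) ↔ N.det ≠ 0 := by
    rw [← Int.cast_ne_zero (α := ℝ), ← hdet, ← isUnit_iff_ne_zero, ← Matrix.isUnit_iff_isUnit_det]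
    exact Matrix.linearIndependent_rows_iff_isUnit (A := N.map (Int.castRingHom ℝ))
  rw [hrow, ne_eq, ← Matrix.exists_mulVec_eq_zero_iff]
  grind

/-- For a `ℤ`-basis `a` of the integer relations of `α` and complementary index families `f`, `g`,
the coordinates of `α` along `g` are independent iff the columns of `a` along `f` are. -/
lemma linearIndependent_coords_iff_columns {m n k : ℕ} (α : Fin m → ℝ) (a : Fin n → Fin m → ℤ)
    (hmem : ∀ i, (∑ j, (a i j : ℝ) * α j) = 0)
    (hbasis : ∀ l : Fin m → ℤ, (∑ j, (l j : ℝ) * α j) = 0 →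
      ∃! c : Fin n → ℤ, l = ∑ i, c i • a i)
    (f : Fin n → Fin m) (g : Fin k → Fin m) (hg : Function.Injective g)
    (hfg : Set.range g = (Set.range f)ᶜ) :
    LinearIndependent ℚ (fun i => α (g i)) ↔
      LinearIndependent ℝ (fun j : Fin n => fun i : Fin n => (a i (f j) : ℝ)) := by
  have hsum : ∀ l : Fin m → ℤ, (∀ j, l (f j) = 0) →
      ∑ j, (l j : ℝ) * α j = ∑ i, (l (g i) : ℝ) * α (g i) := by
    intro l hl
    refine (Fintype.sum_of_injective g hg _ _ (fun x hx => ?_) fun _ => rfl).symm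
    rw [hfg, Set.notMem_compl_iff] at hx
    obtain ⟨j, rfl⟩ := hx
    simp [hl]
  have hker : ∀ (c : Fin n → ℤ) (j : Fin n),
      (Matrix.of fun j i => a i (f j)).mulVec c j = (∑ i, c i • a i) (f j) := by
    intro c j
    simp [Matrix.mulVec, dotProduct, mul_comm]
  rw [← LinearIndependent.iff_fractionRing ℤ ℚ, Fintype.linearIndependent_iff]
  refine Iff.trans ?_ (linearIndependent_intCast_iff_mulVec (Matrix.of fun j i => a i (f j))).symm
  constructor
  · intro h c hc
    have hl : ∀ j, (∑ i, c i • a i) (f j) = 0 := fun j => by rw [← hker, hc]; rfl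
    have hrel : ∑ j, ((∑ i, c i • a i) j : ℝ) * α j = 0 := by
      simp only [Finset.sum_apply, Pi.smul_apply, smul_eq_mul, Int.cast_sum, Int.cast_mul,
        Finset.sum_mul]
      rw [Finset.sum_comm]
      simp [mul_assoc, ← Finset.mul_sum, hmem]
    have hl' := h (fun i => (∑ i, c i • a i) (g i)) (by
      simpa only [zsmul_eq_mul] using (hsum _ hl).symm.trans hrel)
    have hzero : (0 : Fin m → ℤ) = ∑ i, c i • a i := by
      funext x
      by_cases hx : x ∈ Set.range f
      · obtain ⟨j, rfl⟩ := hx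
        exact (hl j).symm
      · rw [← Set.mem_compl_iff, ← hfg] at hx
        obtain ⟨i, rfl⟩ := hx
        exact (hl' i).symm
    exact (hbasis 0 (by simp)).unique hzero (by simp)
  · intro h d hd
    have hlf : ∀ j, Function.extend g d 0 (f j) = 0 := by
      intro j
      refine Function.extend_apply' _ _ _ fun hj => ?_
      have hmem_compl : f j ∈ (Set.range f)ᶜ := hfg ▸ hj
      exact hmem_compl ⟨j, rfl⟩
    obtain ⟨c, hc, -⟩ := hbasis (Function.extend g d 0) (by
      rw [hsum _ hlf]
      simpa [hg.extend_apply] using hd)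
    have hc0 : c = 0 := h c (funext fun j => by rw [hker, ← hc, hlf]; rfl)
    intro i
    rw [← hg.extend_apply d 0 i, hc, hc0]
    simp


/-- Let `α ∈ ℝ^m` with `dim_ℚ(α) = m - n`, let `a_1, …, a_n` be a `ℤ`-basis of
`Λ_α = {l ∈ ℤ^m : l·α = 0}`, and `A` the `n×m` matrix with rows the `a_i`. Then `α`
is rationally uniform (every `m - n` of its coordinates are linearly independent
over `ℚ`) iff the `m` columns of `A` are in linear general position in `ℝ^n`
(every `n` of them are linearly independent over `ℝ`). -/
theorem stmt10 (m n : ℕ) (hnm : n ≤ m) (α : Fin m → ℝ)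
    (hdim : Module.finrank ℚ (Submodule.span ℚ (Set.range α)) = m - n)
    (a : Fin n → Fin m → ℤ)
    (hmem : ∀ i, (∑ j, (a i j : ℝ) * α j) = 0)
    (hbasis : ∀ l : Fin m → ℤ, (∑ j, (l j : ℝ) * α j) = 0 →
      ∃! c : Fin n → ℤ, l = ∑ i, c i • a i) :
    (∀ g : Fin (m - n) → Fin m, Function.Injective g →
        LinearIndependent ℚ (fun i => α (g i))) ↔
    (∀ f : Fin n → Fin m, Function.Injective f →
        LinearIndependent ℝ (fun j : Fin n => fun i : Fin n => (a i (f j) : ℝ))) := by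
  constructor
  · intro h f hf
    obtain ⟨g, hg, hfg⟩ := exists_injective_range_eq_compl (Nat.sub_add_cancel hnm) f hf
    exact (linearIndependent_coords_iff_columns α a hmem hbasis f g hg hfg).1 (h g hg)
  · intro h g hg
    obtain ⟨f, hf, hgf⟩ := exists_injective_range_eq_compl (Nat.add_sub_cancel' hnm) g hg
    have hfg : Set.range g = (Set.range f)ᶜ := by rw [hgf, compl_compl]
    exact (linearIndependent_coords_iff_columns α a hmem hbasis f g hg hfg).2 (h f hf)
end

section
/- Let z_1, …, z_{n+1} ∈ ℤ^n be n + 1 vectors in linear general position, and let Z = ∑_{i=1}^{n+1} [0, z_i] be the lattice zonotope they generate. Then μ(Z) ≤ n/(n+1). -/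
open Pointwise

/-- If the open arcs `(ρ, 1)` on the unit circle have total length less than `1` (one for each index),
then the line `t ↦ c + t • l` with nonzero integer direction meets the cube `[0, ρ]^ι` modulo `ℤ^ι`. -/
lemma exists_forall_fract_le {ι : Type*} [Fintype ι] (ρ : ℝ)
    (hρ : (Fintype.card ι : ℝ) * (1 - ρ) < 1) (c : ι → ℝ) (l : ι → ℤ) (hl : ∀ i, l i ≠ 0) :
    ∃ t : ℝ, ∀ i, Int.fract (c i + t * l i) ≤ ρ := by
  set B : Set UnitAddCircle :=
    Metric.closedBall (((1 + ρ) / 2 : ℝ) : UnitAddCircle) ((1 - ρ) / 2) with hB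
  have hvol : MeasureTheory.volume B ≤ ENNReal.ofReal (1 - ρ) := by
    rw [hB, AddCircle.volume_closedBall]
    apply ENNReal.ofReal_le_ofReal
    exact (min_le_right _ _).trans (by linarith)
  have hpre : ∀ i, MeasureTheory.volume
      ((fun t : UnitAddCircle => (c i : UnitAddCircle) + l i • t) ⁻¹' B) =
        MeasureTheory.volume B := fun i =>
    ((MeasureTheory.measurePreserving_add_left MeasureTheory.volume (c i : UnitAddCircle)).comp
      (MeasureTheory.Measure.measurePreserving_zsmul MeasureTheory.volume (hl i))).measure_preimage
        Metric.isClosed_closedBall.measurableSet.nullMeasurableSet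
  have hlt : MeasureTheory.volume
      (⋃ i, (fun t : UnitAddCircle => (c i : UnitAddCircle) + l i • t) ⁻¹' B) < 1 := by
    calc _ ≤ ∑ i, MeasureTheory.volume
          ((fun t : UnitAddCircle => (c i : UnitAddCircle) + l i • t) ⁻¹' B) :=
            MeasureTheory.measure_iUnion_fintype_le _ _
      _ ≤ ∑ _i : ι, ENNReal.ofReal (1 - ρ) :=
            Finset.sum_le_sum fun i _ => (hpre i).trans_le hvol
      _ = ENNReal.ofReal (Fintype.card ι * (1 - ρ)) := by
            rw [ENNReal.ofReal_mul (Nat.cast_nonneg _), ENNReal.ofReal_natCast]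
            simp
      _ < 1 := by rwa [ENNReal.ofReal_lt_one]
  have hne : (⋃ i, (fun t : UnitAddCircle => (c i : UnitAddCircle) + l i • t) ⁻¹' B)
      ≠ Set.univ := by
    intro h
    rw [h, UnitAddCircle.measure_univ] at hlt
    exact lt_irrefl _ hlt
  obtain ⟨u, hu⟩ := (Set.ne_univ_iff_exists_notMem _).1 hne
  obtain ⟨s, rfl⟩ := QuotientAddGroup.mk_surjective u
  refine ⟨s, fun i => ?_⟩
  by_contra! hgt
  refine hu (Set.mem_iUnion.2 ⟨i, ?_⟩)
  have hcoe : (c i : UnitAddCircle) + l i • (s : UnitAddCircle) - (((1 + ρ) / 2 : ℝ) : UnitAddCircle)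
      = ((c i + s * l i - (1 + ρ) / 2 : ℝ) : UnitAddCircle) := by
    rw [AddCircle.coe_sub, AddCircle.coe_add, mul_comm, ← zsmul_eq_mul, AddCircle.coe_zsmul]
  change (c i : UnitAddCircle) + l i • (s : UnitAddCircle) ∈ B
  rw [hB, mem_closedBall_iff_norm, hcoe, UnitAddCircle.norm_eq]
  refine (round_le _ ⌊c i + s * l i⌋).trans ?_
  have h1 := Int.fract_lt_one (c i + s * l i)
  have h2 := Int.self_sub_floor (c i + s * l i)
  rw [abs_le]
  constructor <;> linarith

/-- In a linear relation among `n + 1` vectors any `n` of which are linearly independent,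
either all coefficients vanish or none does. -/
lemma ne_zero_of_sum_smul_eq_zero {K V : Type*} [Ring K] [AddCommGroup V] [Module K V] {n : ℕ}
    {v : Fin (n + 1) → V}
    (hv : ∀ f : Fin n → Fin (n + 1), Function.Injective f → LinearIndependent K (v ∘ f))
    {g : Fin (n + 1) → K} (hg : ∑ i, g i • v i = 0) (hne : ∃ i, g i ≠ 0) (j : Fin (n + 1)) :
    g j ≠ 0 := by
  intro hj
  obtain ⟨i, hi⟩ := hne
  rw [Fin.sum_univ_succAbove _ j, hj, zero_smul, zero_add] at hg
  have h := Fintype.linearIndependent_iff.1 (hv j.succAbove Fin.succAbove_right_injective)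
    (fun k => g (j.succAbove k)) hg
  rcases Fin.eq_self_or_eq_succAbove j i with rfl | ⟨k, rfl⟩
  · exact hi hj
  · exact hi (h k)

/-- If `z_1, …, z_{n+1} ∈ ℤ^n` are in linear general position, the lattice zonotope
they generate has covering radius at most `n/(n+1)`. -/
theorem stmt12 (n : ℕ) (z : Fin (n + 1) → Fin n → ℤ)
    (hlgp : ∀ f : Fin n → Fin (n + 1), Function.Injective f →
      LinearIndependent ℝ (fun k : Fin n => fun j : Fin n => (z (f k) j : ℝ))) :
    covRad (∑ i : Fin (n + 1), segment ℝ (0 : Fin n → ℝ) (fun j => (z i j : ℝ)))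
      ≤ (n : ℝ) / (n + 1) := by
  set v : Fin (n + 1) → Fin n → ℝ := fun i j => (z i j : ℝ) with hv
  have hn : (0 : ℝ) < n + 1 := by positivity
  obtain ⟨l, hl, hl0⟩ : ∃ l : Fin (n + 1) → ℤ, ∑ i, l i • z i = 0 ∧ ∃ i, l i ≠ 0 := by
    apply Fintype.not_linearIndependent_iff.1
    intro h
    simpa using h.fintype_card_le_finrank
  have hlv : ∑ i, (l i : ℝ) • v i = 0 := by
    ext j
    have := congrFun hl j
    simp only [Finset.sum_apply, Pi.smul_apply, smul_eq_mul, Pi.zero_apply, hv] at this ⊢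
    exact_mod_cast this
  have hlne : ∀ i, l i ≠ 0 := fun i => by
    have := ne_zero_of_sum_smul_eq_zero (v := v) hlgp hlv (by simpa using hl0) i
    simpa using this
  have hspan : ∀ x : Fin n → ℝ, ∃ c : Fin (n + 1) → ℝ, ∑ i, c i • v i = x := fun x => by
    have htop := (hlgp Fin.succ (Fin.succ_injective n)).span_eq_top_of_card_eq_finrank' (by simp)
    obtain ⟨c, hc⟩ := (Submodule.mem_span_range_iff_exists_fun ℝ).1
      (htop ▸ Submodule.mem_top (x := x))
    exact ⟨Fin.cons 0 c, by simpa [Fin.sum_univ_succ] using hc⟩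
  refine le_of_forall_gt_imp_ge_of_dense fun ρ hρ => ?_
  have hρ0 : 0 < ρ := lt_of_le_of_lt (by positivity) hρ
  refine csInf_le ⟨0, fun r hr => hr.1.le⟩ ⟨hρ0, fun x => ?_⟩
  obtain ⟨c, hc⟩ := hspan x
  obtain ⟨t, ht⟩ := exists_forall_fract_le ρ (by
    rw [div_lt_iff₀ hn] at hρ
    simp only [Fintype.card_fin, Nat.cast_add, Nat.cast_one]
    linarith) c l hlne
  refine ⟨ρ • ∑ i, (Int.fract (c i + t * l i) / ρ) • v i, ∑ i, ⌊c i + t * l i⌋ • z i, ?_, ?_⟩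
  · refine Set.smul_mem_smul_set (Set.finsetSum_mem_finsetSum _ _ _ fun i _ => ?_)
    rw [segment_eq_image]
    exact ⟨_, ⟨div_nonneg (Int.fract_nonneg _) hρ0.le, (div_le_one hρ0).2 (ht i)⟩, by simp [hv]⟩
  · have hfloor : (fun j => (((∑ i, ⌊c i + t * l i⌋ • z i) j : ℤ) : ℝ))
        = ∑ i, (⌊c i + t * l i⌋ : ℝ) • v i := by
      ext j
      simp [hv, Finset.sum_apply]
    rw [hfloor, Finset.smul_sum, ← Finset.sum_add_distrib]
    calc x = ∑ i, c i • v i + t • ∑ i, (l i : ℝ) • v i := by rw [hlv, smul_zero, add_zero, hc]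
      _ = ∑ i, (c i + t * l i) • v i := by
        simp only [Finset.smul_sum, add_smul, mul_smul, Finset.sum_add_distrib]
      _ = _ := Finset.sum_congr rfl fun i _ => by
        rw [smul_smul, mul_div_cancel₀ _ hρ0.ne', ← add_smul, Int.fract_add_floor]
end

section
/- Let Z = ∑_{i=1}^{n} [0, e_i] + [0, 1_n] ⊆ ℝ^n be the lattice zonotope generated by the standard basis vectors e_1, …, e_n together with the all-ones vector 1_n = (1, …, 1)^T. Then μ(Z) = n/(n+1). -/
open Pointwise

/-- Membership in the dilate of the zonotope by a positive factor `ρ`. -/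
theorem mem_smul_zonotope_iff {n : ℕ} {ρ : ℝ} (hρ : 0 < ρ) (y : Fin n → ℝ) :
    y ∈ ρ • ((∑ i : Fin n, segment ℝ (0 : Fin n → ℝ) (Pi.single i 1))
        + segment ℝ (0 : Fin n → ℝ) (fun _ => 1)) ↔
      ∃ t : ℝ, 0 ≤ t ∧ t ≤ ρ ∧ ∀ i, 0 ≤ y i - t ∧ y i - t ≤ ρ := by
  simp only [Set.mem_smul_set, Set.mem_add, Set.mem_fintype_sum, segment_eq_image]
  constructor
  · rintro ⟨_, ⟨_, ⟨g, hg, rfl⟩, _, ⟨t, ⟨ht0, ht1⟩, rfl⟩, rfl⟩, rfl⟩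
    choose s hs hsg using hg
    have hsum (i : Fin n) : (∑ j, g j) i = s i := by
      simp [← hsg, Finset.sum_apply, Pi.single_apply]
    refine ⟨ρ * t, by positivity, by nlinarith, fun i => ?_⟩
    obtain ⟨h0, h1⟩ := hs i
    have hy : (ρ • ((∑ j, g j) + ((1 - t) • (0 : Fin n → ℝ) + t • fun _ => (1 : ℝ))) : Fin n → ℝ) i
        - ρ * t = ρ * s i := by
      simp only [Pi.smul_apply, Pi.add_apply, hsum, smul_eq_mul, Pi.zero_apply]
      ring
    rw [hy]
    exact ⟨by positivity, by nlinarith⟩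
  · rintro ⟨t, ht0, ht1, h⟩
    refine ⟨fun i => y i / ρ, ⟨fun i => (y i - t) / ρ,
      ⟨fun i => ((y i - t) / ρ) • Pi.single i 1, fun i => ⟨(y i - t) / ρ,
        ⟨div_nonneg (h i).1 hρ.le, (div_le_one hρ).2 (h i).2⟩, by simp⟩, ?_⟩,
      fun _ => t / ρ, ⟨t / ρ, ⟨div_nonneg ht0 hρ.le, (div_le_one hρ).2 ht1⟩, ?_⟩, ?_⟩, ?_⟩
    · ext i
      simp [Finset.sum_apply, Pi.single_apply]
    · ext i
      simp
    · ext i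
      simp only [Pi.add_apply]
      ring
    · ext i
      simp only [Pi.smul_apply, smul_eq_mul]
      field_simp

/-- Among the `n + 1` translations by multiples of `1 / (n + 1)`, one brings all `n` coordinates
into `[0, n / (n + 1)]` modulo `1`. -/
theorem exists_forall_fract_sub_div_le {n : ℕ} (x : Fin n → ℝ) :
    ∃ j : Fin (n + 1), ∀ i, Int.fract (x i - (j : ℝ) / (n + 1)) ≤ (n : ℝ) / (n + 1) := by
  by_contra! H
  choose f hf using H
  have hn : (0 : ℝ) < n + 1 := by positivity
  obtain ⟨a, b, hab, hfab⟩ : ∃ a b : Fin (n + 1), a < b ∧ f a = f b := by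
    obtain ⟨a, b, hne, h⟩ := Fintype.exists_ne_map_eq_of_card_lt f (by simp)
    rcases lt_or_gt_of_ne hne with h' | h'
    · exact ⟨a, b, h', h⟩
    · exact ⟨b, a, h', h.symm⟩
  have ha := hf a
  have hb := hf b
  rw [← hfab] at hb
  set u := x (f a)
  have hd1 : (a : ℝ) + 1 ≤ b := by exact_mod_cast hab
  have hd2 : (b : ℝ) ≤ n := by exact_mod_cast Nat.lt_succ_iff.1 b.2
  have ha0 : (0 : ℝ) ≤ a := by positivity
  have hdiff : ((b : ℝ) - a) / (n + 1) ≤ n / (n + 1) := by gcongr; linarith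
  have hdiff' : 1 / ((n : ℝ) + 1) ≤ ((b : ℝ) - a) / (n + 1) := by gcongr; linarith
  have hone : (n : ℝ) / (n + 1) + 1 / (n + 1) = 1 := by field_simp
  have hlt := Int.fract_lt_one (u - (a : ℝ) / (n + 1))
  have hsub := sub_div (b : ℝ) a (n + 1)
  have hfr : Int.fract (u - (b : ℝ) / (n + 1))
      = Int.fract (u - (a : ℝ) / (n + 1)) - ((b : ℝ) - a) / (n + 1) := by
    refine Int.fract_eq_iff.2 ⟨by linarith, by linarith, ⌊u - (a : ℝ) / (n + 1)⌋, ?_⟩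
    have := Int.self_sub_floor (u - (a : ℝ) / (n + 1))
    linarith
  linarith

/-- For `ρ < n / (n + 1)` some point has, after every translation by `t ∈ [0, ρ]`, a coordinate
in the open interval `(ρ, 1)`. -/
theorem exists_forall_exists_sub_mem_Ioo {n : ℕ} {ρ : ℝ} (h : ρ < (n : ℝ) / (n + 1)) :
    ∃ x : Fin n → ℝ, ∀ t, 0 ≤ t → t ≤ ρ → ∃ i, x i - t ∈ Set.Ioo ρ 1 := by
  have hn : (0 : ℝ) < n + 1 := by positivity
  set δ := ((n : ℝ) / (n + 1) - ρ) / 2 with hδ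
  have hone : (n : ℝ) / (n + 1) + 1 / (n + 1) = 1 := by field_simp
  refine ⟨fun i => 1 - δ + (i : ℝ) / (n + 1), fun t ht0 ht1 => ?_⟩
  have hs : 0 < (t + δ) * (n + 1) := mul_pos (by linarith) hn
  obtain ⟨k, hk⟩ : ∃ k, ⌈(t + δ) * (n + 1)⌉₊ = k + 1 :=
    Nat.exists_eq_succ_of_ne_zero (Nat.ceil_pos.2 hs).ne'
  have hlo : (k : ℝ) < (t + δ) * (n + 1) := Nat.lt_ceil.1 (by omega)
  have hhi : (t + δ) * (n + 1) ≤ (k : ℝ) + 1 := by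
    have := Nat.le_ceil ((t + δ) * ((n : ℝ) + 1))
    rw [hk] at this
    exact_mod_cast this
  have hub : (t + δ) * (n + 1) < n := (lt_div_iff₀ hn).1 (by linarith)
  have hkn : k < n := by exact_mod_cast hlo.trans hub
  have hlo' : (k : ℝ) / (n + 1) < t + δ := (div_lt_iff₀ hn).2 hlo
  have hhi' : t + δ ≤ (k : ℝ) / (n + 1) + 1 / (n + 1) := by
    rw [← add_div]
    exact (le_div_iff₀ hn).2 hhi
  exact ⟨⟨k, hkn⟩, by dsimp only; linarith, by dsimp only; linarith⟩

/-- The lattice zonotope generated by the standard basis vectors `e_1, …, e_n`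
together with the all-ones vector has covering radius exactly `n/(n+1)`. -/
theorem stmt13 (n : ℕ) :
    covRad ((∑ i : Fin n, segment ℝ (0 : Fin n → ℝ) (Pi.single i 1))
        + segment ℝ (0 : Fin n → ℝ) (fun _ => 1))
      = (n : ℝ) / (n + 1) := by
  have hn : (0 : ℝ) < n + 1 := by positivity
  refine csInf_eq_of_forall_ge_of_forall_gt_exists_lt ?_ ?_ ?_
  · refine ⟨1, one_pos, fun x => ⟨fun i => Int.fract (x i), fun i => ⌊x i⌋,
      (mem_smul_zonotope_iff one_pos _).2 ⟨0, le_rfl, zero_le_one, fun i => ?_⟩, ?_⟩⟩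
    · simpa using (Int.fract_lt_one (x i)).le
    · ext i
      simp
  · rintro ρ ⟨hρ, hcov⟩
    by_contra! hlt
    obtain ⟨x, hx⟩ := exists_forall_exists_sub_mem_Ioo hlt
    obtain ⟨y, k, hy, rfl⟩ := hcov x
    obtain ⟨t, ht0, ht1, h⟩ := (mem_smul_zonotope_iff hρ y).1 hy
    obtain ⟨i, hi1, hi2⟩ := hx t ht0 ht1
    obtain ⟨h1, h2⟩ := h i
    simp only [Pi.add_apply] at hi1 hi2
    have hk1 : (0 : ℝ) < k i := by linarith
    have hk2 : (k i : ℝ) < 1 := by linarith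
    have : 0 < k i := by exact_mod_cast hk1
    have : k i < 1 := by exact_mod_cast hk2
    omega
  · intro w hw
    rcases Nat.eq_zero_or_pos n with rfl | hpos
    · have hw0 : 0 < w := by simpa using hw
      refine ⟨w / 2, ⟨by positivity, fun x => ⟨x, fun _ => 0, ?_, Subsingleton.elim _ _⟩⟩,
        by linarith⟩
      exact (mem_smul_zonotope_iff (by positivity) _).2
        ⟨0, le_rfl, by positivity, fun i => i.elim0⟩
    · have hρ : (0 : ℝ) < n / (n + 1) := by positivity
      refine ⟨n / (n + 1), ⟨hρ, fun x => ?_⟩, hw⟩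
      obtain ⟨j, hj⟩ := exists_forall_fract_sub_div_le x
      refine ⟨fun i => Int.fract (x i - (j : ℝ) / (n + 1)) + (j : ℝ) / (n + 1),
        fun i => ⌊x i - (j : ℝ) / (n + 1)⌋, (mem_smul_zonotope_iff hρ _).2
          ⟨(j : ℝ) / (n + 1), by positivity, ?_, fun i => ?_⟩, ?_⟩
      · have : (j : ℝ) ≤ n := by exact_mod_cast Nat.lt_succ_iff.1 j.2
        gcongr
      · rw [add_sub_cancel_right]
        exact ⟨Int.fract_nonneg _, hj i⟩
      · ext i
        have := Int.self_sub_floor (x i - (j : ℝ) / (n + 1))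
        simp only [Pi.add_apply]
        linarith
end

section
/- For integers 0 ≤ n ≤ m, define ε̄(n, m) = sup{ε ∈ [0, 1/2] : for every u_0 ∈ ℝ^m and every α ∈ ℝ^m all of whose coordinates are nonzero and with dim_ℚ(α) ≥ m − n, the set {u_0 + tα : t ∈ ℝ} + ℤ^m has nonempty intersection with the cube [ε, 1−ε]^m}. Then for all n ≤ m, ε̄(n, m+1) ≤ ε̄(n, m). -/
/-- `ε̄(n, m)`: the supremum of all `ε ∈ [0, 1/2]` such that for every `u₀ ∈ ℝ^m`
and every `α ∈ ℝ^m` with all coordinates nonzero and `dim_ℚ(α) ≥ m - n`, the set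
`{u₀ + tα : t ∈ ℝ} + ℤ^m` meets the cube `[ε, 1-ε]^m`. -/
noncomputable def epsBar (n m : ℕ) : ℝ :=
  sSup {ε : ℝ | 0 ≤ ε ∧ ε ≤ 1 / 2 ∧
    ∀ u₀ α : Fin m → ℝ, (∀ i, α i ≠ 0) →
      m - n ≤ Module.finrank ℚ (Submodule.span ℚ (Set.range α)) →
      ∃ (t : ℝ) (k : Fin m → ℤ), ∀ i,
        ε ≤ u₀ i + t * α i + (k i : ℝ) ∧ u₀ i + t * α i + (k i : ℝ) ≤ 1 - ε}

/-- A finite set of reals does not span `ℝ` over `ℚ`. -/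
lemma exists_notMem_span_rat_range {ι : Type*} [Finite ι] (α : ι → ℝ) :
    ∃ x : ℝ, x ∉ Submodule.span ℚ (Set.range α) := by
  by_contra! h
  have htop : Submodule.span ℚ (Set.range α) = ⊤ := Submodule.eq_top_iff'.mpr h
  have hfin : Module.Finite ℚ ℝ :=
    ⟨htop ▸ Submodule.fg_span (Set.finite_range α)⟩
  have hlt := Module.rank_lt_aleph0 ℚ ℝ
  rw [Real.rank_rat_real] at hlt
  exact absurd hlt (not_lt.mpr Cardinal.aleph0_le_continuum)

/-- Appending a coordinate outside the span raises the dimension of the span. -/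
lemma finrank_span_range_lt_finrank_span_range_snoc {K V : Type*} [DivisionRing K]
    [AddCommGroup V] [Module K V] {m : ℕ} (α : Fin m → V) {x : V}
    (hx : x ∉ Submodule.span K (Set.range α)) :
    Module.finrank K (Submodule.span K (Set.range α)) <
      Module.finrank K
        (Submodule.span K (Set.range (Fin.snoc α x : Fin (m + 1) → V))) := by
  have : Module.Finite K
      (Submodule.span K (Set.range (Fin.snoc α x : Fin (m + 1) → V))) :=
    Module.Finite.span_of_finite K (Set.finite_range _)
  refine Submodule.finrank_lt_finrank_of_lt (lt_of_le_of_ne (Submodule.span_mono ?_) ?_)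
  · rintro _ ⟨i, rfl⟩
    exact ⟨i.castSucc, by simp⟩
  · intro h
    exact hx (h ▸ Submodule.subset_span ⟨Fin.last m, by simp⟩)

/-- For all `n ≤ m`, `ε̄(n, m+1) ≤ ε̄(n, m)`. -/
theorem stmt14 (n m : ℕ) (hnm : n ≤ m) : epsBar n (m + 1) ≤ epsBar n m := by
  refine csSup_le_csSup ⟨1 / 2, fun ε h => h.2.1⟩ ⟨0, le_rfl, by norm_num, ?_⟩ ?_
  · intro u₀ α _ _
    refine ⟨0, fun i => -⌊u₀ i⌋, fun i => ?_⟩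
    push_cast
    constructor <;> linarith [Int.floor_le (u₀ i), Int.lt_floor_add_one (u₀ i)]
  · rintro ε ⟨h₀, h₁, h⟩
    refine ⟨h₀, h₁, fun u₀ α hα hdim => ?_⟩
    obtain ⟨x, hx⟩ := exists_notMem_span_rat_range α
    have hlt := finrank_span_range_lt_finrank_span_range_snoc α hx
    obtain ⟨t, k, hk⟩ := h (Fin.snoc u₀ 0) (Fin.snoc α x)
      (Fin.lastCases (by simpa using fun h0 : x = 0 => hx (h0 ▸ Submodule.zero_mem _))
        (by simpa using hα))
      (by omega)
    exact ⟨t, fun i => k i.castSucc, fun i => by simpa using hk i.castSucc⟩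
end

section
/- Let n ≤ m be positive integers, let S = {z_1, …, z_m} ⊆ ℤ^n be a set of m distinct vectors in linear general position, and let Z = ∑_{i=1}^m [0, z_i] be the lattice zonotope generated by S. Then for every nonzero v ∈ ℤ^n, the width of Z in direction v satisfies w(Z, v) = max_{x ∈ Z} x·v − min_{x ∈ Z} x·v ≥ m − n + 1; consequently the lattice width w(Z) = min_{v ∈ ℤ^n \ {0}} w(Z, v) satisfies w(Z) ≥ m − n + 1. -/
open Pointwise

/-- The width of a set `K ⊆ ℝ^n` in direction `v`. -/
noncomputable def widthIn (n : ℕ) (K : Set (Fin n → ℝ)) (v : Fin n → ℝ) : ℝ :=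
  sSup ((fun x => ∑ i, x i * v i) '' K) - sInf ((fun x => ∑ i, x i * v i) '' K)

/-- The lattice width of a set `K ⊆ ℝ^n`: the infimum of the widths in nonzero
integer directions. -/
noncomputable def latWidth (n : ℕ) (K : Set (Fin n → ℝ)) : ℝ :=
  sInf {w : ℝ | ∃ v : Fin n → ℤ, v ≠ 0 ∧ w = widthIn n K (fun i => (v i : ℝ))}

/-- A vector orthogonal to `n` linearly independent vectors of `ℝ^n` is zero. -/
theorem eq_zero_of_linearIndependent_of_dotProduct_eq_zero {n : ℕ} {b : Fin n → Fin n → ℝ}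
    (hb : LinearIndependent ℝ b) {v : Fin n → ℝ} (hv : ∀ k, ∑ j, b k j * v j = 0) : v = 0 := by
  have hu : IsUnit (Matrix.of b) := Matrix.linearIndependent_rows_iff_isUnit.mp hb
  refine Matrix.eq_zero_of_mulVec_eq_zero ?_ (funext hv : (Matrix.of b).mulVec v = 0)
  exact ((Matrix.isUnit_iff_isUnit_det _).mp hu).ne_zero

/-- The width of a zonotope in direction `v` is at least the sum of the absolute values of the
pairings of its generators with `v`. -/
theorem sum_abs_le_widthIn_sum_segment {n m : ℕ} (z : Fin m → Fin n → ℝ) (v : Fin n → ℝ) :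
    ∑ i, |∑ j, z i j * v j| ≤ widthIn n (∑ i, segment ℝ (0 : Fin n → ℝ) (z i)) v := by
  set Z : Set (Fin n → ℝ) := ∑ i, segment ℝ (0 : Fin n → ℝ) (z i) with hZ
  set a : Fin m → ℝ := fun i => ∑ j, z i j * v j with ha
  have pairing : ∀ t : Fin m → ℝ,
      ∑ j, (∑ i, t i • z i) j * v j = ∑ i, t i * a i := by
    intro t
    simp only [ha, Finset.sum_apply, Pi.smul_apply, smul_eq_mul, Finset.sum_mul, Finset.mul_sum]
    rw [Finset.sum_comm]
    simp only [mul_assoc]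
  have mem_image : ∀ t : Fin m → ℝ, (∀ i, t i ∈ Set.Icc (0 : ℝ) 1) →
      ∑ i, t i * a i ∈ (fun x : Fin n → ℝ => ∑ j, x j * v j) '' Z := by
    intro t ht
    refine ⟨∑ i, t i • z i, ?_, pairing t⟩
    rw [hZ, Set.mem_fintype_sum]
    refine ⟨fun i => t i • z i, fun i => ?_, rfl⟩
    rw [segment_eq_image]
    exact ⟨t i, ht i, by simp⟩
  have bound : ∀ y ∈ (fun x : Fin n → ℝ => ∑ j, x j * v j) '' Z, |y| ≤ ∑ i, |a i| := by
    rintro _ ⟨x, hx, rfl⟩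
    rw [hZ, Set.mem_fintype_sum] at hx
    obtain ⟨g, hg, rfl⟩ := hx
    simp only [segment_eq_image, smul_zero, zero_add] at hg
    choose t ht hgt using hg
    obtain rfl : (fun i => t i • z i) = g := funext hgt
    beta_reduce
    rw [pairing]
    refine (Finset.abs_sum_le_sum_abs _ _).trans (Finset.sum_le_sum fun i _ => ?_)
    rw [abs_mul, abs_of_nonneg (ht i).1]
    exact mul_le_of_le_one_left (abs_nonneg _) (ht i).2
  have hsup := le_csSup ⟨_, fun y hy => (abs_le.mp (bound y hy)).2⟩
    (mem_image (fun i => if 0 ≤ a i then 1 else 0) fun i => by split_ifs <;> simp)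
  have hinf := csInf_le ⟨_, fun y hy => (abs_le.mp (bound y hy)).1⟩
    (mem_image (fun i => if 0 ≤ a i then 0 else 1) fun i => by split_ifs <;> simp)
  have habs : ∑ i, |a i| = ∑ i, (if 0 ≤ a i then 1 else 0) * a i
      - ∑ i, (if 0 ≤ a i then 0 else 1) * a i := by
    rw [← Finset.sum_sub_distrib]
    refine Finset.sum_congr rfl fun i _ => ?_
    split_ifs with h
    · simp [abs_of_nonneg h]
    · simp [abs_of_neg (not_le.mp h)]
  unfold widthIn
  linarith

/-- Fewer than `n` vectors of a family in linear general position are orthogonal to a given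
nonzero vector. -/
theorem card_filter_dotProduct_eq_zero_lt {n m : ℕ} (z : Fin m → Fin n → ℤ)
    (hlgp : ∀ f : Fin n → Fin m, Function.Injective f →
      LinearIndependent ℝ (fun k : Fin n => fun j : Fin n => (z (f k) j : ℝ)))
    {v : Fin n → ℤ} (hv : v ≠ 0) :
    (Finset.univ.filter fun i => ∑ j, z i j * v j = 0).card < n := by
  by_contra! h
  obtain ⟨s, hs, hcard⟩ := Finset.exists_subset_card_eq h
  have h0 := eq_zero_of_linearIndependent_of_dotProduct_eq_zero
    (hlgp (s.orderEmbOfFin hcard) (s.orderEmbOfFin hcard).injective)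
    (v := fun j => (v j : ℝ)) fun k => by
      have := (Finset.mem_filter.mp (hs (s.orderEmbOfFin_mem hcard k))).2
      exact_mod_cast this
  exact hv (funext fun j => Int.cast_eq_zero.mp (congrFun h0 j))

/-- If `z_1, …, z_m ∈ ℤ^n` are `m` distinct vectors in linear general position
(`1 ≤ n ≤ m`), then the lattice zonotope `Z = ∑ [0, z_i]` has width at least
`m - n + 1` in every nonzero integer direction, and hence lattice width at least
`m - n + 1`. -/
theorem stmt16 (n m : ℕ) (hn : 1 ≤ n) (hnm : n ≤ m)
    (z : Fin m → Fin n → ℤ) (hinj : Function.Injective z)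
    (hlgp : ∀ f : Fin n → Fin m, Function.Injective f →
      LinearIndependent ℝ (fun k : Fin n => fun j : Fin n => (z (f k) j : ℝ))) :
    (∀ v : Fin n → ℤ, v ≠ 0 →
      ((m : ℝ) - n + 1) ≤
        widthIn n (∑ i : Fin m, segment ℝ (0 : Fin n → ℝ) (fun j => (z i j : ℝ)))
          (fun i => (v i : ℝ)))
    ∧ ((m : ℝ) - n + 1) ≤
        latWidth n (∑ i : Fin m, segment ℝ (0 : Fin n → ℝ) (fun j => (z i j : ℝ))) := by
  have main : ∀ v : Fin n → ℤ, v ≠ 0 →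
      ((m : ℝ) - n + 1) ≤
        widthIn n (∑ i : Fin m, segment ℝ (0 : Fin n → ℝ) (fun j => (z i j : ℝ)))
          (fun i => (v i : ℝ)) := by
    intro v hv
    refine le_trans ?_ (sum_abs_le_widthIn_sum_segment _ _)
    have hlt := card_filter_dotProduct_eq_zero_lt z hlgp hv
    have hsplit := Finset.card_filter_add_card_filter_not (s := Finset.univ)
      fun i => ∑ j, z i j * v j = 0
    rw [Finset.card_univ, Fintype.card_fin] at hsplit
    have hle : ((Finset.univ.filter fun i => ¬ ∑ j, z i j * v j = 0).card : ℤ) ≤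
        ∑ i, |∑ j, z i j * v j| := by
      rw [Finset.card_filter, Nat.cast_sum]
      refine Finset.sum_le_sum fun i _ => ?_
      split_ifs with h
      · simp
      · exact_mod_cast Int.one_le_abs h
    have hint : (m : ℤ) - n + 1 ≤ ∑ i, |∑ j, z i j * v j| := by omega
    exact_mod_cast hint
  refine ⟨main, le_csInf ?_ ?_⟩
  · exact ⟨_, Pi.single ⟨0, hn⟩ 1, by simp, rfl⟩
  · rintro _ ⟨v, hv, rfl⟩
    exact main v hv
end

section
/- Let α ∈ ℝ^m be a vector all of whose coordinates are nonzero. Then there exists β ∈ ℤ^m all of whose coordinates are nonzero such that every l ∈ ℤ^m with l·α = 0 also satisfies l·β = 0; consequently Λ_α ⊆ Λ_β and E_β ⊆ E_α. -/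
/-- For every `α ∈ ℝ^m` with all coordinates nonzero, there exists `β ∈ ℤ^m` with
all coordinates nonzero such that every integer vector orthogonal to `α` is also
orthogonal to `β`; consequently `Λ_α ⊆ Λ_β` and `E_β ⊆ E_α`. -/
theorem stmt19 (m : ℕ) (α : Fin m → ℝ) (hα : ∀ i, α i ≠ 0) :
    ∃ β : Fin m → ℤ, (∀ i, β i ≠ 0) ∧
      (∀ l : Fin m → ℤ, (∑ i, (l i : ℝ) * α i) = 0 → (∑ i, l i * β i) = 0) ∧
      (∀ ξ : Fin m → ℝ,
        (∀ l : Fin m → ℤ, (∑ i, l i * β i) = 0 →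
          ∃ z : ℤ, (∑ i, (l i : ℝ) * ξ i) = (z : ℝ)) →
        (∀ l : Fin m → ℤ, (∑ i, (l i : ℝ) * α i) = 0 →
          ∃ z : ℤ, (∑ i, (l i : ℝ) * ξ i) = (z : ℝ))) := by
  obtain ⟨f, hf⟩ := Module.exists_dual_forall_apply_ne_zero (K := ℚ) α hα
  obtain ⟨b, hb⟩ := IsLocalization.exist_integer_multiples_of_finite (nonZeroDivisors ℤ)
    (fun i => f (α i))
  choose β hβ using hb
  have hβf : ∀ i, (β i : ℚ) = ((b : ℤ) : ℚ) * f (α i) := fun i => by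
    simpa [zsmul_eq_mul] using hβ i
  have hb0 : ((b : ℤ) : ℚ) ≠ 0 := Int.cast_ne_zero.mpr (nonZeroDivisors.coe_ne_zero b)
  have orth : ∀ l : Fin m → ℤ, (∑ i, (l i : ℝ) * α i) = 0 → (∑ i, l i * β i) = 0 := by
    intro l hl
    have key : ∑ i, (l i : ℚ) * f (α i) = 0 := by
      have h := congrArg f hl
      simpa only [← zsmul_eq_mul, map_sum, map_zsmul, map_zero] using h
    have hcast : ((∑ i, l i * β i : ℤ) : ℚ) = 0 := by
      push_cast
      simp only [hβf, mul_left_comm _ ((b : ℤ) : ℚ), ← Finset.mul_sum, key, mul_zero]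
    exact_mod_cast hcast
  refine ⟨β, fun i hi => ?_, orth, fun ξ hξ l hl => hξ l (orth l hl)⟩
  have h := hβf i
  rw [hi, Int.cast_zero] at h
  exact mul_ne_zero hb0 (hf i) h.symm
end
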